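/- arXiv:0809.0830 — 4 statements merged into one kernel-verified Lean document; each statement's English description precedes it below -/
import Mathlib

section
/- The imaginary quadratic field Q(√-1365) has class number 16. -/
open scoped nonZeroDivisors

namespace Zsqrtd

variable {d : ℤ}

theorem isDomain_of_neg (hd : d < 0) : IsDomain (ℤ√d) :=
  have : NoZeroDivisors (ℤ√d) :=
    ⟨fun {x y} h => by
      rw [← norm_eq_zero_iff hd x, ← norm_eq_zero_iff hd y, ← mul_eq_zero, ← norm_mul, h, norm_zero]⟩
  NoZeroDivisors.to_isDomain _

/-- The ideal of `ℤ√d` generated by `a` and `b + √d`, attached to the binary quadratic form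
`a x² + 2 b x y + ((b² - d) / a) y²`. -/
def formIdeal (d a b : ℤ) : Ideal (ℤ√d) := Ideal.span {(a : ℤ√d), ⟨b, 1⟩}

theorem formIdeal_ne_bot (a b : ℤ) : formIdeal d a b ≠ ⊥ := by
  intro h
  have h1 : (⟨b, 1⟩ : ℤ√d) ∈ formIdeal d a b := Ideal.subset_span (by simp)
  rw [h, Ideal.mem_bot] at h1
  simpa using congrArg im h1

/-- An ideal containing a positive integer `n` of least norm among its nonzero elements is an
integer multiple of the ideal attached to a reduced form. -/
theorem exists_eq_span_mul_formIdeal {I : Ideal (ℤ√d)} {n : ℤ} (hn : 0 < n)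
    (hnI : (n : ℤ√d) ∈ I) (hmin : ∀ x ∈ I, x ≠ 0 → n ^ 2 ≤ x.norm) :
    ∃ a b m : ℤ, 0 < a ∧ a ∣ b ^ 2 - d ∧ -a ≤ 2 * b ∧ 2 * b < a ∧ a ^ 2 ≤ b ^ 2 - d ∧
      m ≠ 0 ∧ I = Ideal.span {(m : ℤ√d)} * formIdeal d a b := by
  have hdvd_int (k : ℤ) (hk : (k : ℤ√d) ∈ I) : n ∣ k := by
    have hr : ((k % n : ℤ) : ℤ√d) ∈ I := by
      have := I.sub_mem hk (I.mul_mem_left ((k / n : ℤ) : ℤ√d) hnI)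
      rw [Int.emod_def]
      push_cast
      convert this using 1
      ring
    by_contra hnk
    have h0 : k % n ≠ 0 := fun h => hnk (Int.dvd_of_emod_eq_zero h)
    have h1 := hmin _ hr (by exact_mod_cast h0)
    rw [norm_intCast] at h1
    have h2 := Int.emod_nonneg k hn.ne'
    have h3 := Int.emod_lt_of_pos k hn
    nlinarith
  -- the least positive imaginary part of an element
  have hex : ∃ y : ℕ, 0 < y ∧ ∃ x : ℤ, (⟨x, y⟩ : ℤ√d) ∈ I := by
    refine ⟨n.toNat, by omega, 0, ?_⟩
    have := I.mul_mem_left sqrtd hnI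
    rw [Int.toNat_of_nonneg hn.le]
    convert this using 1
    ext <;> simp
  classical
  obtain ⟨hy, x₀, hx₀⟩ := Nat.find_spec hex
  set y : ℕ := Nat.find hex
  have hmem_add (x k : ℤ) (h : (⟨x, y⟩ : ℤ√d) ∈ I) : (⟨x - n * k, y⟩ : ℤ√d) ∈ I := by
    convert I.sub_mem h (I.mul_mem_left (k : ℤ√d) hnI) using 1
    ext <;> simp [mul_comm]
  have hdvd_im (z : ℤ√d) (hz : z ∈ I) : (y : ℤ) ∣ z.im := by
    by_contra hyz
    have hpos : (0 : ℤ) < y := by exact_mod_cast hy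
    have h0 : z.im % y ≠ 0 := fun h => hyz (Int.dvd_of_emod_eq_zero h)
    have h2 := Int.emod_nonneg z.im hpos.ne'
    have h3 := Int.emod_lt_of_pos z.im hpos
    refine Nat.find_min hex (m := (z.im % y).toNat) (by omega) ⟨by omega, ?_⟩
    refine ⟨z.re - x₀ * (z.im / y), ?_⟩
    rw [Int.toNat_of_nonneg h2, Int.emod_def]
    convert I.sub_mem hz (I.mul_mem_left ((z.im / y : ℤ) : ℤ√d) hx₀) using 1
    ext <;> simp [mul_comm]
  have hpos : (0 : ℤ) < y := by exact_mod_cast hy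
  obtain ⟨x, hxI, hx1, hx2⟩ :
      ∃ x : ℤ, (⟨x, y⟩ : ℤ√d) ∈ I ∧ -n ≤ 2 * x ∧ 2 * x < n := by
    refine ⟨x₀ - n * ((2 * x₀ + n) / (2 * n)), hmem_add _ _ hx₀, ?_, ?_⟩
    · have := Int.mul_ediv_self_le (x := 2 * x₀ + n) (k := 2 * n) (by omega)
      linarith
    · have := Int.lt_mul_ediv_self_add (x := 2 * x₀ + n) (k := 2 * n) (by omega)
      linarith
  obtain ⟨a, rfl⟩ : (y : ℤ) ∣ n := by
    simpa using hdvd_im _ (I.mul_mem_left sqrtd hnI)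
  obtain ⟨b, rfl⟩ : (y : ℤ) ∣ x := by
    simpa using hdvd_im _ (I.mul_mem_left sqrtd hxI)
  have ha : 0 < a := pos_of_mul_pos_right hn hpos.le
  refine ⟨a, b, y, ha, ?_, by nlinarith, by nlinarith, ?_, hpos.ne', ?_⟩
  · have h1 : (((y : ℤ) * (b ^ 2 - d) : ℤ) : ℤ√d) ∈ I := by
      convert I.mul_mem_left (⟨b, -1⟩ : ℤ√d) hxI using 1
      rw [intCast_val]
      ext <;> simp <;> ring
    exact Int.dvd_of_mul_dvd_mul_left hpos.ne' (hdvd_int _ h1)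
  · have h1 := hmin _ hxI (fun h => hpos.ne' (by simpa using congrArg im h))
    rw [norm_def] at h1
    have h2 : (y : ℤ) ^ 2 * a ^ 2 ≤ (y : ℤ) ^ 2 * (b ^ 2 - d) := by
      simp only at h1
      linarith
    exact le_of_mul_le_mul_left h2 (by positivity)
  · rw [formIdeal, Ideal.span_mul_span', Set.singleton_mul, Set.image_pair]
    have hgen : ((y : ℤ) : ℤ√d) * ⟨b, 1⟩ = ⟨y * b, y⟩ := by ext <;> simp
    rw [hgen, ← Int.cast_mul]
    apply _root_.le_antisymm
    · intro z hz
      obtain ⟨k, hk⟩ := hdvd_im z hz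
      have h1 : ((z.re - y * b * k : ℤ) : ℤ√d) ∈ I := by
        convert I.sub_mem hz (I.mul_mem_left (k : ℤ√d) hxI) using 1
        ext <;> simp [hk, mul_comm]
      obtain ⟨l, hl⟩ := hdvd_int _ h1
      rw [Ideal.mem_span_pair]
      refine ⟨l, k, ?_⟩
      ext
      · simp at hl ⊢
        linarith
      · simp [hk, mul_comm]
    · rw [Ideal.span_le]
      rintro z (rfl | rfl)
      · exact hnI
      · exact hxI

theorem exists_span_mul_eq_span_mul_formIdeal (hd : d < 0) {I : Ideal (ℤ√d)} (hI : I ≠ ⊥) :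
    ∃ a b : ℤ, 0 < a ∧ a ∣ b ^ 2 - d ∧ -a ≤ 2 * b ∧ 2 * b < a ∧ a ^ 2 ≤ b ^ 2 - d ∧
      ∃ x y : ℤ√d, x ≠ 0 ∧ y ≠ 0 ∧ Ideal.span {x} * I = Ideal.span {y} * formIdeal d a b := by
  have := isDomain_of_neg hd
  obtain ⟨w, hwI, hw⟩ := Submodule.exists_mem_ne_zero_of_ne_bot hI
  obtain ⟨α, ⟨hαI, hα⟩, hmin⟩ := WellFounded.has_min
    (measure fun z : ℤ√d => z.norm.toNat).wf {z | z ∈ I ∧ z ≠ 0} ⟨w, hwI, hw⟩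
  have hnorm (z : ℤ√d) (hz : z ≠ 0) : 0 < z.norm :=
    (norm_nonneg hd.le z).lt_of_ne' (mt (norm_eq_zero_iff hd z).1 hz)
  have hsα : star α ≠ 0 := star_ne_zero.2 hα
  obtain ⟨a, b, m, ha, h1, h2, h3, h4, hm, h5⟩ :=
    exists_eq_span_mul_formIdeal (I := Ideal.span {star α} * I) (n := α.norm) (hnorm α hα)
      (by
        rw [norm_eq_mul_conj, mul_comm α]
        exact Ideal.mul_mem_mul (Ideal.mem_span_singleton_self _) hαI)
      (by
        intro z hz hz0
        obtain ⟨β, hβ, rfl⟩ := Ideal.mem_span_singleton_mul.1 hz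
        have hβ0 : β ≠ 0 := right_ne_zero_of_mul hz0
        have h := hmin β ⟨hβ, hβ0⟩
        have h' : α.norm ≤ β.norm := by
          have := hnorm α hα
          have := hnorm β hβ0
          change ¬ β.norm.toNat < α.norm.toNat at h
          omega
        rw [norm_mul, norm_conj, sq]
        exact mul_le_mul_of_nonneg_left h' (hnorm α hα).le)
  exact ⟨a, b, ha, h1, h2, h3, h4, star α, m, hsα, by exact_mod_cast hm, h5⟩

/-- The ideal attached to a primitive ambiguous form `(a, 2b, c)` has square `(a)`. -/
theorem formIdeal_mul_self {a b c : ℤ} (hc : a * c = b ^ 2 - d) (hb : a ∣ 2 * b)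
    (hac : IsCoprime a c) :
    formIdeal d a b * formIdeal d a b = Ideal.span {(a : ℤ√d)} := by
  obtain ⟨k, hk⟩ := hb
  obtain ⟨u, v, huv⟩ := hac
  have hsq : (⟨b, 1⟩ * ⟨b, 1⟩ : ℤ√d) = a * (k * ⟨b, 1⟩ - c) := by
    ext <;> simp
    · linear_combination b * hk + hc
    · linear_combination hk
  rw [formIdeal, Ideal.span_pair_mul_span_pair, hsq]
  apply _root_.le_antisymm
  · rw [Ideal.span_le]
    rintro z (rfl | rfl | rfl | rfl) <;> rw [SetLike.mem_coe, Ideal.mem_span_singleton]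
    exacts [dvd_mul_right _ _, dvd_mul_right _ _, dvd_mul_left _ _, dvd_mul_right _ _]
  · rw [Ideal.span_singleton_le_iff_mem]
    have huv' : (u * a + v * c : ℤ√d) = 1 := by exact_mod_cast huv
    have h : (a : ℤ√d) = u * (a * a) + v * k * (a * ⟨b, 1⟩) - v * (a * (k * ⟨b, 1⟩ - c)) := by
      linear_combination -(a : ℤ√d) * huv'
    have hmem := fun w hw => Ideal.subset_span (s := {(a * a : ℤ√d), a * (⟨b, 1⟩ : ℤ√d),
      (⟨b, 1⟩ : ℤ√d) * a, a * (k * (⟨b, 1⟩ : ℤ√d) - c)}) (a := w) hw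
    exact (congrArg (· ∈ _) h).mpr <| sub_mem
      (add_mem (Ideal.mul_mem_left _ _ (hmem _ (.inl rfl)))
        (Ideal.mul_mem_left _ _ (hmem _ (.inr (.inl rfl)))))
      (Ideal.mul_mem_left _ _ (hmem _ (.inr (.inr (.inr rfl)))))

theorem span_mul_formIdeal_neg {a b : ℤ} (h : a ^ 2 = b ^ 2 - d) :
    Ideal.span {(⟨b, 1⟩ : ℤ√d)} * formIdeal d a (-b) =
      Ideal.span {(a : ℤ√d)} * formIdeal d a b := by
  have h1 : (⟨b, 1⟩ * ⟨-b, 1⟩ : ℤ√d) = -(a * a) := by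
    ext <;> simp
    linear_combination h
  simp only [formIdeal, Ideal.span_mul_span', Set.singleton_mul, Set.image_pair, h1]
  rw [Ideal.span_insert, Ideal.span_insert, Ideal.span_singleton_neg, mul_comm, sup_comm]

theorem isSquare_of_mul_sq_eq_mul_sq {p q s m : ℤ} (hm : m ≠ 0) (h : s ^ 2 * p = m ^ 2 * q) :
    IsSquare (p * q) := by
  have h1 : (s * p) ^ 2 = m ^ 2 * (p * q) := by linear_combination p * h
  obtain ⟨k, hk⟩ := (Int.pow_dvd_pow_iff two_ne_zero).1 (Dvd.intro _ h1.symm)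
  refine ⟨k, mul_left_cancel₀ (pow_ne_zero 2 hm) ?_⟩
  rw [← h1, hk]
  ring

/-- Equivalent ideals with squares `(p)` and `(q)` exist only if `p q` or `-d p q` is a square. -/
theorem isSquare_or_isSquare_of_span_mul_eq (hd : d < -1) {I J : Ideal (ℤ√d)} {p q : ℤ}
    (hp : 0 < p) (hq : 0 < q) (hI : I * I = Ideal.span {(p : ℤ√d)})
    (hJ : J * J = Ideal.span {(q : ℤ√d)}) {x y : ℤ√d} (hy : y ≠ 0)
    (h : Ideal.span {x} * I = Ideal.span {y} * J) :
    IsSquare (p * q) ∨ IsSquare (-d * p * q) := by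
  have hd0 : d < 0 := by omega
  have := isDomain_of_neg hd0
  have h1 : Ideal.span {x * x * p} = Ideal.span {y * y * (q : ℤ√d)} := by
    simp only [← Ideal.span_singleton_mul_span_singleton, ← hI, ← hJ]
    rw [mul_mul_mul_comm, h, mul_mul_mul_comm]
  obtain ⟨u, hu⟩ := Ideal.span_singleton_eq_span_singleton.1 h1
  have hun : (u : ℤ√d).norm = 1 := (norm_eq_one_iff' hd0.le _).2 u.isUnit
  rw [norm_def] at hun
  have him : (u : ℤ√d).im = 0 := by
    by_contra h0
    have : 0 < (u : ℤ√d).im ^ 2 := by positivity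
    nlinarith [sq_nonneg (u : ℤ√d).re]
  have hre : (u : ℤ√d).re * (u : ℤ√d).re = 1 := by simpa [him] using hun
  have hM : y.norm ≠ 0 := mt (norm_eq_zero_iff hd0 y).1 hy
  set z := x * star y with hz
  have hu' : (u : ℤ√d) = ((u : ℤ√d).re : ℤ) := by ext <;> simp [him]
  have key : z * z * p * ((u : ℤ√d).re : ℤ) = (y.norm : ℤ√d) * y.norm * q := by
    rw [← hu', norm_eq_mul_conj, hz]
    linear_combination star y * star y * hu
  have kre := congrArg re key
  have kim := congrArg im key
  simp only [re_mul, im_mul, re_intCast, im_intCast, mul_zero, zero_mul, add_zero, zero_add]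
    at kre kim
  have hMq : 0 < y.norm ^ 2 * q := by positivity
  rcases mul_self_eq_one_iff.1 hre with hr | hr <;> rw [hr] at kre kim
  all_goals
    have hst : z.re * z.im = 0 := by
      have : z.re * z.im * p = 0 := by linarith
      simpa [hp.ne'] using this
    rcases mul_eq_zero.1 hst with h0 | h0 <;> rw [h0] at kre
  · nlinarith [mul_nonneg (sq_nonneg z.im) hp.le]
  · left
    exact isSquare_of_mul_sq_eq_mul_sq (s := z.re) hM (by linarith)
  · right
    exact isSquare_of_mul_sq_eq_mul_sq (s := z.im) hM (by linarith)
  · nlinarith [mul_nonneg (sq_nonneg z.re) hp.le]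

/-- The reduced forms `(a, 2b, c)` of discriminant `-5460`, up to the equivalence of `(37, 4, 37)`
with `(37, -4, 37)`, as pairs `(a, b)`. -/
def reducedForms : Finset (ℤ × ℤ) :=
  {(1, 0), (3, 0), (5, 0), (7, 0), (13, 0), (15, 0), (21, 0), (35, 0), (37, -2),
    (2, -1), (6, -3), (10, -5), (14, -7), (26, -13), (30, -15), (42, -21)}

theorem mem_reducedForms {a b : ℤ} (ha : 0 < a) (hdvd : a ∣ b ^ 2 - (-1365)) (hb : -a ≤ 2 * b)
    (hb' : 2 * b < a) (hle : a ^ 2 ≤ b ^ 2 - (-1365)) :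
    (a, b) ∈ reducedForms ∨ (a, b) = (37, 2) := by
  have ha' : a ≤ 42 := by nlinarith
  have key : ∀ a ∈ Finset.Icc (1 : ℤ) 42, ∀ b ∈ Finset.Icc (-21 : ℤ) 21,
      a ∣ b ^ 2 - (-1365) → -a ≤ 2 * b → 2 * b < a → a ^ 2 ≤ b ^ 2 - (-1365) →
      (a, b) ∈ reducedForms ∨ (a, b) = (37, 2) := by
    decide +kernel
  exact key a (Finset.mem_Icc.2 ⟨ha, ha'⟩) b (Finset.mem_Icc.2 ⟨by omega, by omega⟩) hdvd hb hb' hle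

/-- The middle coefficient (halved) of the ambiguous form of discriminant `-5460` with leading
coefficient `n`. -/
def ambiguousCoeff (n : ℤ) : ℤ := if 2 ∣ n then n / 2 else 0

/-- The positive divisors of `210`. -/
def ambiguousNorms : Finset ℤ := {1, 2, 3, 5, 6, 7, 10, 14, 15, 21, 30, 35, 42, 70, 105, 210}

theorem formIdeal_ambiguousCoeff_mul_self {n : ℤ} (hn : n ∈ ambiguousNorms) :
    formIdeal (-1365) n (ambiguousCoeff n) * formIdeal (-1365) n (ambiguousCoeff n) =
      Ideal.span {(n : ℤ√(-1365))} := by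
  have key : ∀ n ∈ ambiguousNorms,
      n * ((ambiguousCoeff n ^ 2 - (-1365)) / n) = ambiguousCoeff n ^ 2 - (-1365) ∧
      n ∣ 2 * ambiguousCoeff n ∧
      Int.gcd n ((ambiguousCoeff n ^ 2 - (-1365)) / n) = 1 := by
    decide +kernel
  obtain ⟨h1, h2, h3⟩ := key n hn
  exact formIdeal_mul_self h1 h2 (Int.isCoprime_iff_gcd_eq_one.2 h3)

theorem eq_of_isSquare_mul {m n : ℤ} (hm : m ∈ ambiguousNorms) (hn : n ∈ ambiguousNorms)
    (h : IsSquare (m * n) ∨ IsSquare (-(-1365) * m * n)) : m = n := by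
  have key : ∀ m ∈ ambiguousNorms, ∀ n ∈ ambiguousNorms,
      IsSquare (m * n) ∨ IsSquare (-(-1365) * m * n) → m = n := by
    decide +kernel
  exact key m hm n hn h

/-- The class of the ideal attached to a form. -/
noncomputable def formClass [IsDedekindDomain (ℤ√d)] (a b : ℤ) :
    ClassGroup (ℤ√d) :=
  ClassGroup.mk0 ⟨formIdeal d a b, mem_nonZeroDivisors_of_ne_zero (formIdeal_ne_bot a b)⟩

theorem formClass_eq_mk0 [IsDedekindDomain (ℤ√d)] {a b : ℤ} {I : Ideal (ℤ√d)}
    (hI : I ∈ (Ideal (ℤ√d))⁰) {x y : ℤ√d} (hx : x ≠ 0) (hy : y ≠ 0)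
    (h : Ideal.span {x} * I = Ideal.span {y} * formIdeal d a b) :
    formClass a b = ClassGroup.mk0 ⟨I, hI⟩ := by
  rw [formClass, eq_comm, ClassGroup.mk0_eq_mk0_iff]
  exact ⟨x, y, hx, hy, h⟩

theorem exists_of_formClass_eq [IsDedekindDomain (ℤ√d)] {a b a' b' : ℤ}
    (h : (formClass a b : ClassGroup (ℤ√d)) = formClass a' b') :
    ∃ x y : ℤ√d, x ≠ 0 ∧ y ≠ 0 ∧
      Ideal.span {x} * formIdeal d a b = Ideal.span {y} * formIdeal d a' b' := by
  obtain ⟨x, y, hx, hy, hxy⟩ := ClassGroup.mk0_eq_mk0_iff.1 h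
  exact ⟨x, y, hx, hy, hxy⟩

theorem formClass_neg [IsDedekindDomain (ℤ√d)] {a b : ℤ} (ha : a ≠ 0)
    (h : a ^ 2 = b ^ 2 - d) : (formClass a (-b) : ClassGroup (ℤ√d)) = formClass a b :=
  (formClass_eq_mk0 _ (fun h0 => by simpa using congrArg im h0) (by exact_mod_cast ha)
    (span_mul_formIdeal_neg h)).symm

theorem card_classGroup [IsDedekindDomain (ℤ√(-1365))] :
    Nat.card (ClassGroup (ℤ√(-1365))) = 16 := by
  have hsurj : Function.Surjective
      fun p : reducedForms => (formClass p.1.1 p.1.2 : ClassGroup (ℤ√(-1365))) := by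
    intro C
    obtain ⟨⟨I, hI⟩, rfl⟩ := ClassGroup.mk0_surjective C
    obtain ⟨a, b, h1, h2, h3, h4, h5, x, y, hx, hy, hxy⟩ :=
      exists_span_mul_eq_span_mul_formIdeal (by norm_num) (nonZeroDivisors.ne_zero hI)
    have hC := formClass_eq_mk0 hI hx hy hxy
    rcases mem_reducedForms h1 h2 h3 h4 h5 with h | h
    · exact ⟨⟨(a, b), h⟩, hC⟩
    · obtain ⟨rfl, rfl⟩ := Prod.mk.inj h
      exact ⟨⟨(37, -2), by decide⟩, (formClass_neg (by norm_num) (by norm_num)).trans hC⟩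
  have hinj : Function.Injective fun n : ambiguousNorms =>
      (formClass n.1 (ambiguousCoeff n.1) : ClassGroup (ℤ√(-1365))) := by
    intro m n h
    obtain ⟨x, y, hx, hy, hxy⟩ := exists_of_formClass_eq h
    have hpos : ∀ n ∈ ambiguousNorms, 0 < n := by decide
    exact Subtype.ext <| eq_of_isSquare_mul m.2 n.2 <|
      isSquare_or_isSquare_of_span_mul_eq (by norm_num) (hpos _ m.2) (hpos _ n.2)
        (formIdeal_ambiguousCoeff_mul_self m.2) (formIdeal_ambiguousCoeff_mul_self n.2) hy hxy
  have : Finite (ClassGroup (ℤ√(-1365))) := Finite.of_surjective _ hsurj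
  have h1 := Nat.card_le_card_of_surjective _ hsurj
  have h2 := Nat.card_le_card_of_injective _ hinj
  simp only [Nat.card_eq_fintype_card (α := reducedForms),
    Nat.card_eq_fintype_card (α := ambiguousNorms), Fintype.card_coe] at h1 h2
  have h3 : reducedForms.card = 16 := by decide
  have h4 : ambiguousNorms.card = 16 := by decide
  omega

end Zsqrtd

theorem exists_eq_add_mul_of_sq_eq {K : Type*} [Field K] [NumberField K]
    (hdeg : Module.finrank ℚ K = 2) {x : K} (hx : x ^ 2 = -1365) (z : K) :
    ∃ p q : ℚ, z = p + q * x := by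
  have hxQ (r : ℚ) : (r : K) ≠ x := by
    rintro rfl
    have : r ^ 2 = -1365 := by exact_mod_cast hx
    nlinarith [sq_nonneg r]
  have hli : LinearIndependent ℚ ![1, x] := by
    rw [LinearIndependent.pair_iff' one_ne_zero]
    intro r
    simpa [Algebra.smul_def] using hxQ r
  have htop := hli.span_eq_top_of_card_eq_finrank' (by simp [hdeg])
  have hz : z ∈ Submodule.span ℚ (Set.range ![1, x]) := htop ▸ Submodule.mem_top
  rw [Matrix.range_cons, Matrix.range_cons, Matrix.range_empty, Set.union_empty,
    Set.singleton_union, Submodule.mem_span_pair] at hz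
  obtain ⟨p, q, h⟩ := hz
  exact ⟨p, q, by simpa [Algebra.smul_def] using h.symm⟩

open Polynomial in
theorem exists_trace_norm_of_isIntegral {K : Type*} [Field K] [CharZero K] {x : K}
    (hx : x ^ 2 = -1365) {p q : ℚ} (hz : IsIntegral ℤ (p + q * x : K)) :
    ∃ t n : ℤ, 2 * p = t ∧ p ^ 2 + 1365 * q ^ 2 = n := by
  by_cases hq : q = 0
  · subst hq
    obtain ⟨n, rfl⟩ : ∃ n : ℤ, (n : ℚ) = p := by
      have hp : IsIntegral ℤ (algebraMap ℚ K p) := by simpa using hz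
      rw [isIntegral_algebraMap_iff (algebraMap ℚ K).injective] at hp
      exact IsIntegrallyClosed.isIntegral_iff.1 hp
    exact ⟨2 * n, n ^ 2, by push_cast; ring, by push_cast; ring⟩
  set z : K := p + q * x with hz_def
  set P : ℚ[X] := X ^ 2 + C (-(2 * p)) * X + C (p ^ 2 + 1365 * q ^ 2) with hP
  have hPdeg : P.natDegree = 2 := by rw [hP]; compute_degree!
  have hPmonic : P.Monic := by rw [hP]; monicity!
  have hroot : aeval z P = 0 := by
    simp [hP, hz_def]
    linear_combination (q : K) ^ 2 * hx
  have hzQ : z ∉ (algebraMap ℚ K).range := by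
    rintro ⟨r, hr⟩
    have hr' : (r : K) = p + q * x := by simpa using hr
    have h1 : (r - p) ^ 2 = -1365 * q ^ 2 := by
      have : ((r : K) - p) ^ 2 = -1365 * (q : K) ^ 2 := by
        rw [hr', ← hx]
        ring
      exact_mod_cast this
    have : 0 < q ^ 2 := by positivity
    nlinarith [sq_nonneg (r - p)]
  have hmin : P = minpoly ℚ z :=
    eq_of_monic_of_dvd_of_natDegree_le (minpoly.monic hz.tower_top) hPmonic
      (minpoly.dvd ℚ z hroot)
      (hPdeg.trans_le ((minpoly.two_le_natDegree_iff hz.tower_top).2 hzQ))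
  rw [minpoly.isIntegrallyClosed_eq_field_fractions' ℚ hz] at hmin
  have h0 := congrArg (coeff · 0) hmin
  have h1 := congrArg (coeff · 1) hmin
  simp [hP, coeff_X, -map_add, -map_mul, -map_pow, coeff_C] at h0 h1
  exact ⟨-(minpoly ℤ z).coeff 1, (minpoly ℤ z).coeff 0, by push_cast; linarith, h0⟩

theorem exists_int_of_trace_norm {p q : ℚ} {t n : ℤ} (ht : 2 * p = t)
    (hn : p ^ 2 + 1365 * q ^ 2 = n) : ∃ a b : ℤ, p = a ∧ q = b := by
  obtain ⟨v, hv⟩ : ∃ v : ℤ, 2 * q = v := by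
    have h1 : 1365 * (2 * q) ^ 2 = (4 * n - t ^ 2 : ℤ) := by
      push_cast
      rw [← ht, ← hn]
      ring
    have hden : ((2 * q).den : ℤ) ^ 2 ∣ 1365 := by
      have h2 : 1365 * (2 * q).num ^ 2 = (4 * n - t ^ 2) * ((2 * q).den : ℤ) ^ 2 := by
        have h3 := Rat.mul_den_eq_num (2 * q)
        have h4 : (1365 : ℚ) * (2 * q).num ^ 2 = (4 * n - t ^ 2 : ℤ) * ((2 * q).den : ℚ) ^ 2 := by
          rw [← h3, ← h1]
          ring
        exact_mod_cast h4
      exact (((2 * q).isCoprime_num_den.symm).pow).dvd_of_dvd_mul_right (Dvd.intro_left _ h2.symm)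
    have hsf : ∀ k ∈ Finset.Icc 1 36, k ^ 2 ∣ 1365 → k = 1 := by decide
    have hone : (2 * q).den = 1 := by
      have hden' : (2 * q).den ^ 2 ∣ 1365 := by exact_mod_cast hden
      have hle := Nat.le_of_dvd (by norm_num) hden'
      exact hsf _ (Finset.mem_Icc.2 ⟨(2 * q).pos, by nlinarith⟩) hden'
    exact ⟨(2 * q).num, (Rat.coe_int_num_of_den_eq_one hone).symm⟩
  have h4 : t ^ 2 + 1365 * v ^ 2 = 4 * n := by
    have : (t : ℚ) ^ 2 + 1365 * (v : ℚ) ^ 2 = 4 * n := by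
      rw [← ht, ← hv, ← hn]
      ring
    exact_mod_cast this
  have heven : Even t ∧ Even v := by
    rcases Int.even_or_odd' t with ⟨i, rfl | rfl⟩ <;> rcases Int.even_or_odd' v with ⟨j, rfl | rfl⟩
    · exact ⟨even_two_mul i, even_two_mul j⟩
    all_goals ring_nf at h4; omega
  obtain ⟨⟨i, rfl⟩, ⟨j, rfl⟩⟩ := heven
  push_cast at ht hv
  exact ⟨i, j, by linarith, by linarith⟩

/-- The imaginary quadratic field `ℚ(√-1365)` has class number 16. -/
theorem stmt_1 (K : Type*) [Field K] [NumberField K]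
    (hdeg : Module.finrank ℚ K = 2) (hx : ∃ x : K, x ^ 2 = -1365) :
    NumberField.classNumber K = 16 := by
  obtain ⟨x, hx⟩ := hx
  let f : ℤ√(-1365) →+* K := Zsqrtd.lift ⟨x, by push_cast; rw [← hx, sq]⟩
  have hf : Function.Injective f := Zsqrtd.lift_injective _ fun n hn => by nlinarith
  let : Algebra (ℤ√(-1365)) K := f.toAlgebra
  have : IsIntegralClosure (ℤ√(-1365)) ℤ K :=
    { algebraMap_injective := hf
      isIntegral_iff := by
        intro z
        constructor
        · intro hz
          obtain ⟨p, q, rfl⟩ := exists_eq_add_mul_of_sq_eq hdeg hx z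
          obtain ⟨t, n, ht, hn⟩ := exists_trace_norm_of_isIntegral hx hz
          obtain ⟨a, b, rfl, rfl⟩ := exists_int_of_trace_norm ht hn
          refine ⟨⟨a, b⟩, ?_⟩
          change f _ = _
          simp [f, Zsqrtd.lift]
        · rintro ⟨w, rfl⟩
          change IsIntegral ℤ (f w)
          have hxi : IsIntegral ℤ x := by
            refine IsIntegral.of_pow two_pos ?_
            rw [hx]
            exact_mod_cast isIntegral_algebraMap (R := ℤ) (A := K) (x := -1365)
          have hi (k : ℤ) : IsIntegral ℤ (k : K) := isIntegral_algebraMap (R := ℤ) (x := k)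
          simpa [f, Zsqrtd.lift] using (hi w.re).add ((hi w.im).mul hxi) }
  have := Zsqrtd.isDomain_of_neg (d := -1365) (by norm_num)
  have : IsDedekindDomain (ℤ√(-1365)) := IsIntegralClosure.isDedekindDomain ℤ ℚ K _
  rw [NumberField.classNumber, ← Nat.card_eq_fintype_card, ← Zsqrtd.card_classGroup]
  exact Nat.card_congr (ClassGroup.mulEquiv
    (IsIntegralClosure.equiv ℤ (NumberField.RingOfIntegers K) K (ℤ√(-1365))).toRingEquiv).toEquiv
end

section
/- The class group of the imaginary quadratic field of discriminant -5460 is isomorphic to (Z/2Z)^4; in particular it has exponent 2 and order 16. -/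
open Module

section RankTwo

variable {R : Type*} [CommRing R]

theorem repr_fin_two_zero (e : Basis (Fin 2) ℤ R) (x y : ℤ) :
    e.repr (x • e 0 + y • e 1) 0 = x := by
  simp only [map_add, map_smul, Basis.repr_self]
  simp

theorem repr_fin_two_one (e : Basis (Fin 2) ℤ R) (x y : ℤ) :
    e.repr (x • e 0 + y • e 1) 1 = y := by
  simp only [map_add, map_smul, Basis.repr_self]
  simp

/-- Changing a basis of length two by an integer matrix of determinant one. -/
theorem exists_basis_of_det_eq_one (e : Basis (Fin 2) ℤ R) {p q r s : ℤ}
    (h : p * s - q * r = 1) :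
    ∃ b : Basis (Fin 2) ℤ R, b 0 = p • e 0 + q • e 1 ∧ b 1 = r • e 0 + s • e 1 := by
  have hR : (p : R) * s - q * r = 1 := by exact_mod_cast congrArg (Int.cast : ℤ → R) h
  have hli : LinearIndependent ℤ ![p • e 0 + q • e 1, r • e 0 + s • e 1] := by
    rw [LinearIndependent.pair_iff]
    intro m n hmn
    have hmn' : (m * p + n * r) • e 0 + (m * q + n * s) • e 1 = 0 := by
      rw [← hmn]
      module
    have h0 := repr_fin_two_zero e (m * p + n * r) (m * q + n * s)
    have h1 := repr_fin_two_one e (m * p + n * r) (m * q + n * s)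
    simp only [hmn', map_zero, Finsupp.coe_zero, Pi.zero_apply] at h0 h1
    constructor
    · linear_combination -s * h0 + r * h1 - m * h
    · linear_combination -p * h1 + q * h0 - n * h
  refine ⟨Basis.mk hli ?_, by simp, by simp⟩
  rw [← e.span_eq, Submodule.span_le]
  rintro _ ⟨i, rfl⟩
  rw [SetLike.mem_coe, Matrix.range_cons, Matrix.range_cons, Matrix.range_empty,
    Set.union_empty, Set.singleton_union, Submodule.mem_span_pair]
  fin_cases i
  · refine ⟨s, -q, ?_⟩
    simp only [zsmul_eq_mul, Fin.zero_eta, Int.cast_neg]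
    linear_combination e 0 * hR
  · refine ⟨-r, p, ?_⟩
    simp only [zsmul_eq_mul, Fin.mk_one, Int.cast_neg]
    linear_combination e 1 * hR

/-- A commutative ring that is free of rank two over `ℤ` has a `ℤ`-basis starting with `1`. -/
theorem exists_basis_fst_eq_one (e : Basis (Fin 2) ℤ R) :
    ∃ b : Basis (Fin 2) ℤ R, b 0 = 1 := by
  obtain ⟨a, ha⟩ : ∃ a, a = e.repr 1 0 := ⟨_, rfl⟩
  obtain ⟨c, hc⟩ : ∃ c, c = e.repr 1 1 := ⟨_, rfl⟩
  have hone : a • e 0 + c • e 1 = 1 := by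
    have := e.sum_repr 1
    rwa [Fin.sum_univ_two, ← ha, ← hc] at this
  have hcop : IsCoprime a c := by
    rw [Int.isCoprime_iff_gcd_eq_one]
    obtain ⟨a', ha'⟩ := Int.gcd_dvd_left a c
    obtain ⟨c', hc'⟩ := Int.gcd_dvd_right a c
    generalize Int.gcd a c = g at ha' hc'
    have hdvd : (g : ℤ) • ((a' • e 0 + c' • e 1) * e 0) = e 0 := by
      rw [← smul_mul_assoc, smul_add, smul_smul, smul_smul, ← ha', ← hc', hone, one_mul]
    have := congrArg (fun z => e.repr z 0) hdvd
    simp only [map_smul, Finsupp.smul_apply, smul_eq_mul, Basis.repr_self,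
      Finsupp.single_eq_same] at this
    have := Int.eq_one_or_neg_one_of_mul_eq_one this
    omega
  obtain ⟨u, v, huv⟩ := hcop
  obtain ⟨b, hb, -⟩ := exists_basis_of_det_eq_one e (p := a) (q := c) (r := -v) (s := u)
    (by linear_combination huv)
  exact ⟨b, hb.trans hone⟩

theorem leftMulMatrix_of_basis_one (b : Basis (Fin 2) ℤ R) {s t : ℤ} (h₀ : b 0 = 1)
    (h₁ : b 1 * b 1 = s + t * b 1) (x y : ℤ) :
    Algebra.leftMulMatrix b (x + y * b 1) = !![x, y * s; y, x + y * t] := by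
  have key (z w : ℤ) : ((z : R) + w * b 1) = z • b 0 + w • b 1 := by simp [h₀]
  ext i j
  rw [Algebra.leftMulMatrix_eq_repr_mul]
  fin_cases j
  · simp only [Fin.zero_eta, h₀, mul_one]
    rw [key]
    fin_cases i
    · exact repr_fin_two_zero b _ _
    · exact repr_fin_two_one b _ _
  · have : ((x : R) + y * b 1) * b 1 = ((y * s : ℤ) : R) + ((x + y * t : ℤ) : R) * b 1 := by
      push_cast
      linear_combination (y : R) * h₁
    simp only [Fin.mk_one]
    rw [this, key]
    fin_cases i
    · exact repr_fin_two_zero b _ _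
    · exact repr_fin_two_one b _ _

theorem norm_of_basis_one (b : Basis (Fin 2) ℤ R) {s t : ℤ} (h₀ : b 0 = 1)
    (h₁ : b 1 * b 1 = s + t * b 1) (x y : ℤ) :
    Algebra.norm ℤ ((x : R) + y * b 1) = x * x + t * x * y - s * y * y := by
  rw [Algebra.norm_eq_matrix_det b, leftMulMatrix_of_basis_one b h₀ h₁, Matrix.det_fin_two_of]
  ring

theorem trace_of_basis_one (b : Basis (Fin 2) ℤ R) {s t : ℤ} (h₀ : b 0 = 1)
    (h₁ : b 1 * b 1 = s + t * b 1) (x y : ℤ) :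
    Algebra.trace ℤ R ((x : R) + y * b 1) = 2 * x + t * y := by
  rw [Algebra.trace_eq_matrix_trace b, leftMulMatrix_of_basis_one b h₀ h₁,
    Matrix.trace_fin_two_of]
  ring

theorem discr_of_basis_one (b : Basis (Fin 2) ℤ R) {s t : ℤ} (h₀ : b 0 = 1)
    (h₁ : b 1 * b 1 = s + t * b 1) :
    Algebra.discr ℤ b = t * t + 4 * s := by
  have h00 := trace_of_basis_one b h₀ h₁ 1 0
  have h01 := trace_of_basis_one b h₀ h₁ 0 1
  have h11 := trace_of_basis_one b h₀ h₁ s t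
  rw [← h₁] at h11
  simp only [Int.cast_one, Int.cast_zero, zero_mul, one_mul, zero_add, add_zero, mul_one,
    mul_zero] at h00 h01
  rw [Algebra.discr_def, Matrix.det_fin_two]
  simp only [Algebra.traceMatrix_apply, Algebra.traceForm_apply, h₀, one_mul, mul_one, h00, h01,
    h11]
  ring

/-- If the discriminant is `4 * d`, there is a basis `1, θ` with `θ ^ 2 = d`. -/
theorem exists_basis_sq_eq (e : Basis (Fin 2) ℤ R) {d : ℤ}
    (hd : ∀ b : Basis (Fin 2) ℤ R, Algebra.discr ℤ b = 4 * d) :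
    ∃ b : Basis (Fin 2) ℤ R, b 0 = 1 ∧ b 1 * b 1 = d := by
  obtain ⟨b, h₀⟩ := exists_basis_fst_eq_one e
  obtain ⟨s, t, h₁⟩ : ∃ s t : ℤ, b 1 * b 1 = s + t * b 1 := by
    refine ⟨b.repr (b 1 * b 1) 0, b.repr (b 1 * b 1) 1, ?_⟩
    have := b.sum_repr (b 1 * b 1)
    rw [Fin.sum_univ_two, h₀] at this
    simpa using this.symm
  have hst := hd b
  rw [discr_of_basis_one b h₀ h₁] at hst
  obtain ⟨m, hm⟩ : Even t := by
    have : Even (t * t) := ⟨2 * d - 2 * s, by linarith⟩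
    simpa [Int.even_mul] using this
  obtain ⟨b', h0', h1'⟩ := exists_basis_of_det_eq_one b (p := 1) (q := 0) (r := -m) (s := 1)
    (by ring)
  refine ⟨b', by simp [h0', h₀], ?_⟩
  have hs : s = d - m * m := by subst hm; linarith
  subst hm hs
  simp only [h1', h₀, zsmul_eq_mul]
  push_cast at h₁ ⊢
  linear_combination h₁

end RankTwo

/-- Commuting involutions indexed by `ι` define a homomorphism from `(ℤ/2ℤ)^ι`. -/
theorem exists_monoidHom_of_sq_eq_one {ι G : Type*} [Fintype ι] [CommGroup G] (g : ι → G)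
    (hg : ∀ i, g i ^ 2 = 1) :
    ∃ φ : Multiplicative (ι → ZMod 2) →* G,
      ∀ v, φ (Multiplicative.ofAdd v) = ∏ i, g i ^ (v i).val := by
  refine ⟨MonoidHom.mk' (fun v => ∏ i, g i ^ (Multiplicative.toAdd v i).val) ?_, fun v => rfl⟩
  intro v w
  rw [← Finset.prod_mul_distrib]
  refine Finset.prod_congr rfl fun i _ => ?_
  rw [← pow_add, toAdd_mul, Pi.add_apply, ZMod.val_add, ← pow_eq_pow_mod _ (hg i)]

theorem span_pair_mul_self_eq {R : Type*} [CommRing R] {p α β x y z : R} (h : α * α = p * β)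
    (h' : p * x + α * y + β * z = 1) :
    Ideal.span {p, α} * Ideal.span {p, α} = Ideal.span {p} := by
  apply le_antisymm
  · rw [Ideal.span_pair_mul_span_pair, Ideal.span_le]
    rintro w (rfl | rfl | rfl | rfl) <;> rw [SetLike.mem_coe, Ideal.mem_span_singleton]
    · exact dvd_mul_right _ _
    · exact dvd_mul_right _ _
    · exact dvd_mul_left _ _
    · exact ⟨β, h⟩
  · rw [Ideal.span_singleton_le_iff_mem]
    have hp : p ∈ Ideal.span {p, α} := Ideal.subset_span (by simp)
    have hα : α ∈ Ideal.span {p, α} := Ideal.subset_span (by simp)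
    have : p = x * (p * p) + y * (p * α) + z * (α * α) := by
      linear_combination -p * h' - z * h
    have hmem : x * (p * p) + y * (p * α) + z * (α * α) ∈
        Ideal.span {p, α} * Ideal.span {p, α} :=
      add_mem (add_mem (Ideal.mul_mem_left _ _ (Ideal.mul_mem_mul hp hp))
        (Ideal.mul_mem_left _ _ (Ideal.mul_mem_mul hp hα)))
        (Ideal.mul_mem_left _ _ (Ideal.mul_mem_mul hα hα))
    rwa [← this] at hmem

open scoped nonZeroDivisors

/-- The class of an ideal lies in a subgroup as soon as the classes of its prime factors do. -/
theorem mk0_mem_of_forall_prime_dvd {R : Type*} [CommRing R] [IsDedekindDomain R]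
    (H : Subgroup (ClassGroup R)) (I : Ideal R) :
    (∀ Q : Ideal R, Q ∣ I → Prime Q → ∀ hQ : Q ∈ (Ideal R)⁰, ClassGroup.mk0 ⟨Q, hQ⟩ ∈ H) →
    ∀ hI : I ∈ (Ideal R)⁰, ClassGroup.mk0 ⟨I, hI⟩ ∈ H := by
  induction I using UniqueFactorizationMonoid.induction_on_prime with
  | h₁ => exact fun _ hI => (nonZeroDivisors.ne_zero hI rfl).elim
  | h₂ I hu =>
    intro _ hI
    obtain rfl := Ideal.isUnit_iff.mp hu
    rw [(ClassGroup.mk0_eq_one_iff hI).mpr top_isPrincipal]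
    exact one_mem H
  | h₃ J P hJ hP ih =>
    intro h hI
    have hP' : P ∈ (Ideal R)⁰ := mem_nonZeroDivisors_of_ne_zero hP.ne_zero
    have hJ' : J ∈ (Ideal R)⁰ := mem_nonZeroDivisors_of_ne_zero hJ
    have : (⟨P * J, hI⟩ : (Ideal R)⁰) = ⟨P, hP'⟩ * ⟨J, hJ'⟩ := rfl
    rw [this, map_mul]
    exact mul_mem (h P (dvd_mul_right _ _) hP hP')
      (ih (fun Q hQ => h Q (hQ.mul_left _)) hJ')

/-- A square root of `-1365` modulo a prime `p > 7` has a representative `r` such that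
`(r ^ 2 + 1365) / p` only has prime factors below `p`. -/
theorem exists_small_residue {p : ℕ} (hp : p.Prime) (h7 : 7 < p) {r : ℤ}
    (hr : (p : ℤ) ∣ r ^ 2 + 1365) :
    ∃ (r' : ℤ) (n : ℕ), (p : ℤ) ∣ r - r' ∧ r' ^ 2 + 1365 = p * n ∧
      ∀ q, q.Prime → q ∣ n → q < p := by
  have hp0 : 0 < p := hp.pos
  obtain ⟨k, hk⟩ : ∃ k, k = Int.bdiv r p := ⟨_, rfl⟩
  obtain ⟨s, hs⟩ : ∃ s, s = Int.bmod r p := ⟨_, rfl⟩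
  have hsk : s + p * k = r := by rw [hs, hk]; exact Int.bmod_add_bdiv r p
  have h1 := Int.le_bmod (x := r) hp0
  have h2 := Int.bmod_lt (x := r) hp0
  rw [← hs] at h1 h2
  have hrs : (p : ℤ) ∣ r - s := ⟨k, by linarith⟩
  have hps : (p : ℤ) ∣ s ^ 2 + 1365 := by
    have : s ^ 2 + 1365 = r ^ 2 + 1365 - (r - s) * (r + s) := by ring
    rw [this]
    exact dvd_sub hr (hrs.mul_right _)
  clear hr hs hk
  rcases Nat.lt_or_ge p 43 with hlt | hge
  · have hsmall : p = 13 ∧ s = 0 ∨ p = 37 ∧ (s = 2 ∨ s = -2) := by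
      clear hrs hsk
      interval_cases p <;> first
        | (norm_num at hp; done)
        | (norm_num at h1 h2
           interval_cases s <;> first
             | (norm_num at hps; done)
             | norm_num)
    have hfac {N B q : ℕ} (hN : ∀ l ∈ N.primeFactorsList, l < B) (h0 : N ≠ 0) (hq : q.Prime)
        (hqN : q ∣ N) : q < B := hN q ((Nat.mem_primeFactorsList h0).mpr ⟨hq, hqN⟩)
    rcases hsmall with ⟨rfl, rfl⟩ | ⟨rfl, rfl | rfl⟩
    · exact ⟨0, 105, hrs, by norm_num, fun q => hfac (by simp) (by norm_num)⟩
    · exact ⟨-35, 70, by omega, by norm_num, fun q => hfac (by simp) (by norm_num)⟩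
    · exact ⟨35, 70, by omega, by norm_num, fun q => hfac (by simp) (by norm_num)⟩
  · obtain ⟨m, hm⟩ := hps
    have hp43 : (43 : ℤ) ≤ p := by exact_mod_cast hge
    have hm0 : 0 < m := by
      by_contra! hneg
      nlinarith [sq_nonneg s]
    lift m to ℕ using hm0.le
    refine ⟨s, m, hrs, hm, fun q hq hqm => ?_⟩
    have hqm' : (q : ℤ) ≤ m := by exact_mod_cast Nat.le_of_dvd (by exact_mod_cast hm0) hqm
    have hs1 : 2 * s ≤ p := by omega
    have hs2 : -p ≤ 2 * s := by omega
    have : (m : ℤ) < p := by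
      by_contra! hneg
      nlinarith
    omega

theorem norm_eq_sq_add {R : Type*} [CommRing R] (b : Basis (Fin 2) ℤ R) (h₀ : b 0 = 1)
    (h₁ : b 1 * b 1 = ((-1365 : ℤ) : R)) (x y : ℤ) :
    Algebra.norm ℤ ((x : R) + y * b 1) = x ^ 2 + 1365 * y ^ 2 := by
  rw [norm_of_basis_one b (s := -1365) (t := 0) h₀ (by rw [h₁]; simp)]
  ring

theorem exists_ramified {R : Type*} [CommRing R] (b : Basis (Fin 2) ℤ R)
    (h₁ : b 1 * b 1 = ((-1365 : ℤ) : R)) (i : Fin 4) :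
    ∃ P : Ideal R, P * P = Ideal.span {((![2, 3, 5, 7] i : ℕ) : R)} := by
  push_cast at h₁
  fin_cases i
  · refine ⟨_, span_pair_mul_self_eq (α := b 1 - 1) (β := -682 - b 1) (x := 342) (y := 1)
      (z := 1) ?_ ?_⟩
    · simp
      linear_combination h₁
    · simp
      ring
  · refine ⟨_, span_pair_mul_self_eq (α := b 1) (β := -455) (x := 152) (y := 0)
      (z := 1) ?_ ?_⟩
    · simp
      linear_combination h₁
    · simp
      ring
  · refine ⟨_, span_pair_mul_self_eq (α := b 1) (β := -273) (x := -109) (y := 0)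
      (z := -2) ?_ ?_⟩
    · simp
      linear_combination h₁
    · simp
      ring
  · refine ⟨_, span_pair_mul_self_eq (α := b 1) (β := -195) (x := 28) (y := 0)
      (z := 1) ?_ ?_⟩
    · simp
      linear_combination h₁
    · simp
      ring

theorem exists_sub_intCast_mem {R : Type*} [CommRing R] [IsDedekindDomain R]
    [Module.Free ℤ R] {P : Ideal R} (hP : P.absNorm.Prime) (a : R) :
    ∃ r : ℤ, a - r ∈ P := by
  have : Fact P.absNorm.Prime := ⟨hP⟩
  have hne : (Ideal.Quotient.mk P 1) ≠ 0 := by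
    rw [Ne, Ideal.Quotient.eq_zero_iff_mem, ← Ideal.eq_top_iff_one, ← Ideal.absNorm_eq_one_iff]
    exact hP.ne_one
  have hcard : Nat.card (R ⧸ P) = P.absNorm := rfl
  obtain ⟨r, hr⟩ := mem_zmultiples_of_prime_card hcard (g' := Ideal.Quotient.mk P a) hne
  refine ⟨r, ?_⟩
  rw [← Ideal.Quotient.eq_zero_iff_mem, map_sub, sub_eq_zero, ← hr]
  simp

section ClassGroup

variable {R : Type*} [CommRing R] [IsDedekindDomain R] [Module.Free ℤ R] [Module.Finite ℤ R]

theorem absNorm_span_natCast_eq_sq (b : Basis (Fin 2) ℤ R) (n : ℕ) :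
    Ideal.absNorm (Ideal.span {(n : R)}) = n ^ 2 := by
  rw [Ideal.absNorm_span_natCast, Module.finrank_eq_card_basis b, Fintype.card_fin]

/-- In a quadratic order, a prime ideal is principal or has prime norm. -/
theorem isPrincipal_or_prime_absNorm (b : Basis (Fin 2) ℤ R) {P : Ideal R} (hP : Prime P) :
    P.IsPrincipal ∨ P.absNorm.Prime := by
  have hprime : P.IsPrime := Ideal.isPrime_of_prime hP
  have : P.IsMaximal := hprime.isMaximal hP.ne_zero
  obtain ⟨p, n, hn, hpP, hp, hPn⟩ := Ideal.exists_prime_and_absNorm_eq_pow P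
  have hle : Ideal.span {(p : R)} ≤ P := (Ideal.span_singleton_le_iff_mem _).mpr hpP
  obtain ⟨J, hJ⟩ := Ideal.dvd_iff_le.mpr hle
  have hnorm : p ^ 2 = p ^ n * J.absNorm := by
    rw [← absNorm_span_natCast_eq_sq b, hJ, map_mul, hPn]
  have hn2 : n ≤ 2 := (Nat.pow_dvd_pow_iff_le_right hp.one_lt).mp ⟨_, hnorm⟩
  obtain rfl | rfl : n = 1 ∨ n = 2 := by omega
  · exact Or.inr (by rwa [hPn, pow_one])
  · have hJ1 : J.absNorm = 1 :=
      Nat.eq_of_mul_eq_mul_left (pow_pos hp.pos 2) (by rw [← hnorm, mul_one])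
    rw [Ideal.absNorm_eq_one_iff] at hJ1
    rw [hJ1, Ideal.mul_top] at hJ
    exact Or.inl ⟨⟨_, hJ.symm⟩⟩

theorem absNorm_eq_of_mul_self (b : Basis (Fin 2) ℤ R) {P : Ideal R} {p : ℕ}
    (h : P * P = Ideal.span {(p : R)}) :
    P.absNorm = p := by
  have := congrArg Ideal.absNorm h
  rw [map_mul, absNorm_span_natCast_eq_sq b, ← sq] at this
  exact Nat.pow_left_injective two_ne_zero this

/-- A ramified prime is the only prime ideal of its norm. -/
theorem eq_of_mul_self_of_absNorm_eq (b : Basis (Fin 2) ℤ R) {P Q : Ideal R} {p : ℕ}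
    (hp : p ≠ 0) (h : P * P = Ideal.span {(p : R)}) (hQ : Prime Q) (hQp : Q.absNorm = p) : Q = P := by
  have hprime : Q.IsPrime := Ideal.isPrime_of_prime hQ
  have hPQ : P ≤ Q := by
    have hle : P * P ≤ Q := by
      rw [h, Ideal.span_singleton_le_iff_mem, ← hQp]
      exact Q.absNorm_mem
    simpa using hprime.mul_le.mp hle
  obtain ⟨J, hJ⟩ := Ideal.dvd_iff_le.mpr hPQ
  have hn : p = p * J.absNorm := by
    conv_lhs => rw [← absNorm_eq_of_mul_self b h, hJ, map_mul, hQp]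
  have hJ1 : J.absNorm = 1 := Nat.eq_of_mul_eq_mul_left (Nat.pos_of_ne_zero hp) (by omega)
  rw [Ideal.absNorm_eq_one_iff] at hJ1
  rw [hJ, hJ1, Ideal.mul_top]

/-- The norm of a principal ideal is a square if it is less than `1365`. -/
theorem isSquare_absNorm_of_isPrincipal (b : Basis (Fin 2) ℤ R) (h₀ : b 0 = 1)
    (h₁ : b 1 * b 1 = ((-1365 : ℤ) : R)) {I : Ideal R} (hI : I.IsPrincipal)
    (hlt : I.absNorm < 1365) : ∃ x : ℕ, I.absNorm = x ^ 2 := by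
  obtain ⟨⟨z, rfl⟩⟩ := hI
  obtain ⟨x, y, rfl⟩ : ∃ x y : ℤ, z = x + y * b 1 := by
    refine ⟨b.repr z 0, b.repr z 1, ?_⟩
    have := b.sum_repr z
    rw [Fin.sum_univ_two, h₀] at this
    simpa using this.symm
  rw [Ideal.submodule_span_eq, Ideal.absNorm_span_singleton, norm_eq_sq_add b h₀ h₁] at hlt ⊢
  have hy : y = 0 := by
    by_contra hy
    have : 0 < y ^ 2 := by positivity
    have := sq_nonneg x
    omega
  exact ⟨x.natAbs, by simp [hy, Int.natAbs_pow]⟩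

theorem mk0_mem_of_prime (b : Basis (Fin 2) ℤ R) (h₀ : b 0 = 1)
    (h₁ : b 1 * b 1 = ((-1365 : ℤ) : R)) (H : Subgroup (ClassGroup R))
    (hH : ∀ Q : Ideal R, Prime Q → Q.absNorm.Prime → Q.absNorm ≤ 7 →
      ∀ hQ : Q ∈ (Ideal R)⁰, ClassGroup.mk0 ⟨Q, hQ⟩ ∈ H) (p : ℕ) (hp : p.Prime) :
    ∀ P : Ideal R, Prime P → P.absNorm = p →
      ∀ hP : P ∈ (Ideal R)⁰, ClassGroup.mk0 ⟨P, hP⟩ ∈ H := by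
  induction p using Nat.strong_induction_on with
  | _ p ih =>
  intro P hprime hPp hP
  rcases Nat.lt_or_ge 7 p with h7 | h7
  swap
  · exact hH P hprime (hPp ▸ hp) (hPp ▸ h7) hP
  have hnorm (r : ℤ) : Algebra.norm ℤ (b 1 - (r : R)) = r ^ 2 + 1365 := by
    have := norm_eq_sq_add b h₀ h₁ (-r) 1
    rw [show b 1 - (r : R) = ((-r : ℤ) : R) + ((1 : ℤ) : R) * b 1 by push_cast; ring, this]
    ring
  obtain ⟨r₀, hr₀⟩ := exists_sub_intCast_mem (P := P) (hPp ▸ hp) (b 1)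
  have hdvd := Ideal.absNorm_dvd_norm_of_mem hr₀
  rw [hnorm, hPp] at hdvd
  obtain ⟨r, n, ⟨k, hk⟩, hrn, hq⟩ := exists_small_residue hp h7 hdvd
  have hr : b 1 - (r : R) ∈ P := by
    have : b 1 - (r : R) = b 1 - (r₀ : R) + k * (p : R) := by
      have : (r₀ : R) - r = p * k := by exact_mod_cast congrArg (Int.cast : ℤ → R) hk
      linear_combination this
    rw [this]
    exact add_mem hr₀ (Ideal.mul_mem_left _ _ (hPp ▸ P.absNorm_mem))
  obtain ⟨J, hJ⟩ := Ideal.dvd_iff_le.mpr ((Ideal.span_singleton_le_iff_mem _).mpr hr)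
  have hJn : J.absNorm = n := by
    have := congrArg Ideal.absNorm hJ
    rw [map_mul, Ideal.absNorm_span_singleton, hnorm, hrn, hPp] at this
    exact (Nat.eq_of_mul_eq_mul_left hp.pos (by rw [← this]; norm_cast)).symm
  have hn : n ≠ 0 := by
    rintro rfl
    have := sq_nonneg r
    simp at hrn
    omega
  have hJ0 : J ∈ (Ideal R)⁰ := Ideal.absNorm_ne_zero_iff_mem_nonZeroDivisors.mp (hJn ▸ hn)
  have hJH : ClassGroup.mk0 ⟨J, hJ0⟩ ∈ H := by
    refine mk0_mem_of_forall_prime_dvd H J (fun Q hQJ hQ hQ0 => ?_) hJ0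
    rcases isPrincipal_or_prime_absNorm b hQ with hprin | hQp
    · rw [(ClassGroup.mk0_eq_one_iff hQ0).mpr hprin]
      exact one_mem H
    · exact ih _ (hq _ hQp (hJn ▸ map_dvd Ideal.absNorm hQJ)) hQp Q hQ rfl hQ0
  have hmul : ClassGroup.mk0 ⟨P, hP⟩ * ClassGroup.mk0 ⟨J, hJ0⟩ = 1 := by
    rw [← map_mul]
    exact (ClassGroup.mk0_eq_one_iff (mul_mem hP hJ0)).mpr ⟨⟨_, hJ.symm⟩⟩
  rw [eq_inv_of_mul_eq_one_left hmul]
  exact inv_mem hJH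

theorem nonempty_classGroup_mulEquiv (b : Basis (Fin 2) ℤ R) (h₀ : b 0 = 1)
    (h₁ : b 1 * b 1 = ((-1365 : ℤ) : R)) :
    Nonempty (ClassGroup R ≃* Multiplicative (Fin 4 → ZMod 2)) := by
  choose P hP using exists_ramified b h₁
  have hPnorm (i) : (P i).absNorm = ![2, 3, 5, 7] i := absNorm_eq_of_mul_self b (hP i)
  have hpos (i : Fin 4) : (![2, 3, 5, 7] i : ℕ) ≠ 0 := by fin_cases i <;> simp
  have hP0 (i) : P i ∈ (Ideal R)⁰ :=
    Ideal.absNorm_ne_zero_iff_mem_nonZeroDivisors.mp (hPnorm i ▸ hpos i)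
  obtain ⟨φ, hφ⟩ := exists_monoidHom_of_sq_eq_one (fun i => ClassGroup.mk0 ⟨P i, hP0 i⟩)
    fun i => by
      rw [sq, ← map_mul]
      exact (ClassGroup.mk0_eq_one_iff (mul_mem (hP0 i) (hP0 i))).mpr ⟨⟨_, hP i⟩⟩
  refine ⟨(MulEquiv.ofBijective φ ⟨?_, ?_⟩).symm⟩
  · rw [injective_iff_map_eq_one]
    intro v hv
    have hv' := hφ (Multiplicative.toAdd v)
    rw [ofAdd_toAdd, hv] at hv'
    generalize hw : Multiplicative.toAdd v = w at hv'
    have hprod : (∏ i, P i ^ (w i).val).IsPrincipal := by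
      have hmem : ∏ i, P i ^ (w i).val ∈ (Ideal R)⁰ :=
        prod_mem fun i _ => pow_mem (hP0 i) _
      rw [← ClassGroup.mk0_eq_one_iff hmem, hv']
      simp only [← map_pow, ← map_prod]
      congr 1
    have hnorm : (∏ i, P i ^ (w i).val).absNorm = ∏ i, ![2, 3, 5, 7] i ^ (w i).val := by
      simp only [map_prod, map_pow, hPnorm]
    have hdec : ∀ w : Fin 4 → ZMod 2, ∏ i, ![2, 3, 5, 7] i ^ (w i).val < 15 ^ 2 ∧
        ((∃ x < 15, ∏ i, ![2, 3, 5, 7] i ^ (w i).val = x ^ 2) → w = 0) := by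
      decide
    obtain ⟨hlt, hsq⟩ := hdec w
    rw [← hnorm] at hlt hsq
    obtain ⟨x, hx⟩ := isSquare_absNorm_of_isPrincipal b h₀ h₁ hprod (by omega)
    have := hsq ⟨x, lt_of_pow_lt_pow_left₀ 2 (by norm_num) (hx ▸ hlt), hx⟩
    rw [← ofAdd_toAdd v, hw, this, ofAdd_zero]
  · have hgen (i) : ClassGroup.mk0 ⟨P i, hP0 i⟩ ∈ φ.range := by
      refine ⟨Multiplicative.ofAdd (Pi.single i 1), ?_⟩
      rw [hφ, Finset.prod_eq_single i]
      · simp [ZMod.val_one]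
      · intro j _ hj
        simp [hj]
      · simp
    intro C
    obtain ⟨⟨I, hI⟩, rfl⟩ := ClassGroup.mk0_surjective C
    refine mk0_mem_of_forall_prime_dvd φ.range I (fun Q _ hQ hQ0 => ?_) hI
    rcases isPrincipal_or_prime_absNorm b hQ with hprin | hQp
    · rw [(ClassGroup.mk0_eq_one_iff hQ0).mpr hprin]
      exact one_mem _
    refine mk0_mem_of_prime b h₀ h₁ φ.range (fun Q hQ hQp hle hQ0 => ?_) _ hQp Q hQ rfl hQ0
    obtain ⟨i, hi⟩ : ∃ i : Fin 4, Q.absNorm = ![2, 3, 5, 7] i := by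
      generalize Q.absNorm = q at hQp hle
      interval_cases q
      all_goals first
        | exact ⟨0, rfl⟩
        | exact ⟨1, rfl⟩
        | exact ⟨2, rfl⟩
        | exact ⟨3, rfl⟩
        | norm_num at hQp
    obtain rfl := eq_of_mul_self_of_absNorm_eq b (hpos i) (hP i) hQ hi
    exact hgen i

end ClassGroup

/-- The class group of the imaginary quadratic field of discriminant `-5460` is
isomorphic to `(ℤ/2ℤ)⁴`; in particular it has exponent 2 and order 16. -/
theorem stmt_2 (K : Type*) [Field K] [NumberField K]
    (hdeg : Module.finrank ℚ K = 2) (hdisc : NumberField.discr K = -5460) :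
    Nonempty (ClassGroup (NumberField.RingOfIntegers K) ≃*
        Multiplicative (Fin 4 → ZMod 2)) ∧
      Monoid.exponent (ClassGroup (NumberField.RingOfIntegers K)) = 2 ∧
      Nat.card (ClassGroup (NumberField.RingOfIntegers K)) = 16 := by
  have hrank : Module.finrank ℤ (NumberField.RingOfIntegers K) = 2 := by
    rw [NumberField.RingOfIntegers.rank, hdeg]
  obtain ⟨b, h₀, h₁⟩ := exists_basis_sq_eq (d := -1365)
    (Module.finBasisOfFinrankEq ℤ (NumberField.RingOfIntegers K) hrank)
    fun b => by rw [NumberField.discr_eq_discr, hdisc]; norm_num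
  obtain ⟨e⟩ := nonempty_classGroup_mulEquiv b h₀ h₁
  refine ⟨⟨e⟩, ?_, ?_⟩
  · rw [Monoid.exponent_eq_of_mulEquiv e]
    refine (Monoid.exponent_eq_prime_iff Nat.prime_two).mpr fun g hg => orderOf_eq_prime ?_ hg
    rw [← ofAdd_toAdd g, ← ofAdd_nsmul, ← ofAdd_zero]
    congr 1
    ext i
    simp [two_mul, CharTwo.add_self_eq_zero]
  · rw [Nat.card_congr e.toEquiv]
    simp
end

section
/- For each discriminant d in {-15, -20, -24, -35, -40, -51, -52, -88, -91, -115, -123, -148, -187, -232, -267, -403, -427}, the imaginary quadratic field Q(√d) has class number 2. -/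
open NumberField Module Ideal
open scoped nonZeroDivisors

section QuadraticBasis

variable {R S : Type*} [CommRing R] [CommRing S] [Algebra R S]
  {s n : R} {ω : S} (b : Basis (Fin 2) R S)

theorem leftMulMatrix_of_quadratic_basis (hb : ⇑b = ![1, ω])
    (hω : ω ^ 2 = algebraMap R S s * ω - algebraMap R S n) (x y : R) :
    Algebra.leftMulMatrix b (algebraMap R S x + algebraMap R S y * ω) =
      !![x, -(n * y); y, x + s * y] := by
  have h0 : b 0 = 1 := by simp [hb]
  have h1 : b 1 = ω := by simp [hb]
  have hrepr : ∀ u v : R, ∀ i, b.repr (algebraMap R S u + algebraMap R S v * ω) i = ![u, v] i := by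
    intro u v i
    have : algebraMap R S u + algebraMap R S v * ω = u • b 0 + v • b 1 := by
      rw [h0, h1, Algebra.smul_def, Algebra.smul_def, mul_one]
    rw [this]
    fin_cases i <;> simp
  have hmul : (algebraMap R S x + algebraMap R S y * ω) * ω =
      algebraMap R S (-(n * y)) + algebraMap R S (x + s * y) * ω := by
    simp only [map_neg, map_mul, map_add]
    linear_combination (algebraMap R S y) * hω
  ext i j
  rw [Algebra.leftMulMatrix_eq_repr_mul]
  fin_cases j
  · simp only [Fin.zero_eta, h0, mul_one, hrepr]
    fin_cases i <;> rfl
  · simp only [Fin.mk_one, h1, hmul, hrepr]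
    fin_cases i <;> rfl

theorem norm_of_quadratic_basis (hb : ⇑b = ![1, ω])
    (hω : ω ^ 2 = algebraMap R S s * ω - algebraMap R S n) (x y : R) :
    Algebra.norm R (algebraMap R S x + algebraMap R S y * ω) =
      x ^ 2 + s * x * y + n * y ^ 2 := by
  rw [Algebra.norm_eq_matrix_det b, leftMulMatrix_of_quadratic_basis b hb hω, Matrix.det_fin_two_of]
  ring

theorem trace_of_quadratic_basis (hb : ⇑b = ![1, ω])
    (hω : ω ^ 2 = algebraMap R S s * ω - algebraMap R S n) (x y : R) :
    Algebra.trace R S (algebraMap R S x + algebraMap R S y * ω) = 2 * x + s * y := by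
  rw [Algebra.trace_eq_matrix_trace b, leftMulMatrix_of_quadratic_basis b hb hω,
    Matrix.trace_fin_two_of]
  ring

theorem discr_of_quadratic_basis (hb : ⇑b = ![1, ω])
    (hω : ω ^ 2 = algebraMap R S s * ω - algebraMap R S n) :
    Algebra.discr R b = s ^ 2 - 4 * n := by
  have htr := trace_of_quadratic_basis b hb hω
  have h1 := htr 1 0
  have hω1 := htr 0 1
  have hω2 := htr (-n) s
  have hωω : ω * ω = algebraMap R S (-n) + algebraMap R S s * ω := by
    rw [map_neg]; linear_combination hω
  simp only [map_one, map_zero, zero_mul, add_zero, zero_add, one_mul] at h1 hω1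
  rw [Algebra.discr_def, Matrix.det_fin_two]
  simp only [Algebra.traceMatrix_apply, Algebra.traceForm_apply, hb, Matrix.cons_val_zero,
    Matrix.cons_val_one, mul_one, one_mul, h1, hω1, hωω, hω2]
  ring

end QuadraticBasis

/-- Over `ℚ` the elements `1, ω` form a basis of a quadratic field as soon as `ω` is a root of a
quadratic polynomial with negative discriminant. -/
theorem exists_basis_of_quadratic {K : Type*} [Field K] [NumberField K] (hK : finrank ℚ K = 2)
    {s n : ℤ} (hD : 0 < 4 * n - s ^ 2) {ω : K} (hω : ω ^ 2 = s * ω - n) :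
    ∃ b : Basis (Fin 2) ℚ K, ⇑b = ![1, ω] := by
  have hli : LinearIndependent ℚ ![(1 : K), ω] := by
    rw [LinearIndependent.pair_iff' one_ne_zero]
    intro a ha
    rw [Algebra.smul_def, mul_one] at ha
    rw [← ha] at hω
    have h : a ^ 2 = s * a - n := by
      apply (algebraMap ℚ K).injective
      simpa using hω
    have hD' : (0 : ℚ) < 4 * n - s ^ 2 := by exact_mod_cast hD
    nlinarith [sq_nonneg (2 * a - s)]
  exact ⟨basisOfLinearIndependentOfCardEqFinrank hli (by simp [hK]), by simp⟩

theorem isIntegral_of_quadratic {S : Type*} [CommRing S] {s n : ℤ} {ω : S}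
    (hω : ω ^ 2 = s * ω - n) : IsIntegral ℤ ω := by
  refine ⟨.X ^ 2 - .C s * .X + .C n, by monicity!, ?_⟩
  simp only [Polynomial.eval₂_add, Polynomial.eval₂_sub, Polynomial.eval₂_mul,
    Polynomial.eval₂_pow, Polynomial.eval₂_X, Polynomial.eval₂_C, hω]
  simp

/-- If `s² - 4n` is a negative fundamental discriminant, every algebraic integer of the quadratic field
generated by a root `ω` of `X² - sX + n` is an integral combination of `1` and `ω`. -/
theorem exists_eq_add_mul_of_isIntegral {K : Type*} [Field K] [NumberField K]
    (hK : finrank ℚ K = 2) {s n : ℤ} (hD : 0 < 4 * n - s ^ 2)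
    (hfund : ∀ l : ℕ, (l : ℤ) ^ 2 ∣ 4 * n - s ^ 2 →
      l = 1 ∨ l = 2 ∧ s = 0 ∧ (n % 4 = 1 ∨ n % 4 = 2))
    {ω : K} (hω : ω ^ 2 = s * ω - n) {z : K} (hz : IsIntegral ℤ z) :
    ∃ x y : ℤ, z = x + y * ω := by
  obtain ⟨b, hb⟩ := exists_basis_of_quadratic hK hD hω
  have hω' : ω ^ 2 = algebraMap ℚ K s * ω - algebraMap ℚ K n := by simpa using hω
  have hωint : IsIntegral ℤ ω := isIntegral_of_quadratic hω
  obtain ⟨u, v, rfl⟩ : ∃ u v : ℚ, z = algebraMap ℚ K u + algebraMap ℚ K v * ω := by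
    refine ⟨b.repr z 0, b.repr z 1, ?_⟩
    conv_lhs => rw [← b.sum_repr z]
    simp [Fin.sum_univ_two, hb, Algebra.smul_def]
  obtain ⟨T, hT⟩ := IsIntegrallyClosed.isIntegral_iff.mp (Algebra.isIntegral_trace (L := ℚ) hz)
  obtain ⟨N, hN⟩ := IsIntegrallyClosed.isIntegral_iff.mp (Algebra.isIntegral_norm ℚ hz)
  rw [trace_of_quadratic_basis b hb hω'] at hT
  rw [norm_of_quadratic_basis b hb hω'] at hN
  simp only [eq_intCast] at hT hN
  have hdisc : (4 * n - s ^ 2 : ℚ) * v ^ 2 = (4 * N - T ^ 2 : ℤ) := by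
    push_cast; rw [hT, hN]; ring
  have hv : (v.den : ℚ) * v = v.num := by rw [mul_comm]; exact Rat.mul_den_eq_num v
  have hnum : (4 * n - s ^ 2) * v.num ^ 2 = (4 * N - T ^ 2) * (v.den : ℤ) ^ 2 := by
    have : (4 * n - s ^ 2 : ℚ) * v.num ^ 2 = (4 * N - T ^ 2) * (v.den : ℚ) ^ 2 := by
      push_cast at hdisc
      rw [← hdisc, ← hv]; ring
    exact_mod_cast this
  have hcop : IsCoprime ((v.den : ℤ) ^ 2) (v.num ^ 2) := (Int.isCoprime_iff_gcd_eq_one.mpr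
    (show Int.gcd (v.den : ℤ) v.num = 1 from v.reduced.symm)).pow
  have hden : v.den = 1 := by
    rcases hfund v.den (hcop.dvd_of_dvd_mul_right ⟨_, hnum.trans (mul_comm _ _)⟩) with
      h | ⟨h, rfl, h4⟩
    · exact h
    · exfalso
      have hodd : v.num % 2 = 1 := by
        have := v.reduced
        rw [h, Nat.coprime_two_right] at this
        exact Int.odd_iff.mp (Int.natAbs_odd.mp this)
      obtain ⟨k, hk⟩ : ∃ k, v.num = 2 * k + 1 := ⟨v.num / 2, by omega⟩
      rw [h, hk] at hnum
      have key : n * (2 * k + 1) ^ 2 = 4 * N - T ^ 2 := by push_cast at hnum; linarith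
      have hn4 : (n * (2 * k + 1) ^ 2) % 4 = n % 4 := by
        have : n * (2 * k + 1) ^ 2 = n + 4 * (n * (k ^ 2 + k)) := by ring
        omega
      rcases Int.even_or_odd' T with ⟨m, rfl | rfl⟩ <;> ring_nf at key hn4 <;> omega
  obtain ⟨y, rfl⟩ : ∃ y : ℤ, v = y := ⟨v.num, (Rat.coe_int_num_of_den_eq_one hden).symm⟩
  have hu : IsIntegral ℤ (algebraMap ℚ K u) := by
    have := hz.sub ((isIntegral_algebraMap (R := ℤ) (A := K) (x := y)).mul hωint)
    simpa using this
  rw [isIntegral_algebraMap_iff (algebraMap ℚ K).injective] at hu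
  obtain ⟨x, hx⟩ := IsIntegrallyClosed.isIntegral_iff.mp hu
  exact ⟨x, y, by simp [← hx]⟩

/-- The ring of integers of a quadratic field with fundamental discriminant `s² - 4n < 0` has a
basis `1, ω` where `ω` is a root of `X² - sX + n`. -/
theorem exists_integral_basis_of_quadratic {K : Type*} [Field K] [NumberField K]
    (hK : finrank ℚ K = 2) {s n : ℤ} (hD : 0 < 4 * n - s ^ 2)
    (hfund : ∀ l : ℕ, (l : ℤ) ^ 2 ∣ 4 * n - s ^ 2 →
      l = 1 ∨ l = 2 ∧ s = 0 ∧ (n % 4 = 1 ∨ n % 4 = 2))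
    (hx : ∃ x : K, x ^ 2 = ((s ^ 2 - 4 * n : ℤ) : K)) :
    ∃ (ω : 𝓞 K) (b : Basis (Fin 2) ℤ (𝓞 K)),
      ⇑b = ![1, ω] ∧ ω ^ 2 = algebraMap ℤ (𝓞 K) s * ω - algebraMap ℤ (𝓞 K) n := by
  obtain ⟨x, hx⟩ := hx
  push_cast at hx
  have hω : ((s + x) / 2) ^ 2 = s * ((s + x) / 2) - n := by
    linear_combination hx / 4
  have hint : IsIntegral ℤ ((s + x) / 2) := isIntegral_of_quadratic hω
  obtain ⟨ω, hωx⟩ : ∃ ω : 𝓞 K, (ω : K) = (s + x) / 2 := ⟨⟨_, hint⟩, rfl⟩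
  rw [← hωx] at hω
  have hspan : ⊤ ≤ Submodule.span ℤ (Set.range ![1, ω]) := by
    rintro z -
    obtain ⟨u, v, h⟩ :=
      exists_eq_add_mul_of_isIntegral hK hD hfund hω (RingOfIntegers.isIntegral_coe z)
    have hz : z = u • 1 + v • ω := by
      apply RingOfIntegers.coe_injective
      simpa using h
    rw [hz]
    exact add_mem (Submodule.smul_mem _ _ (Submodule.subset_span ⟨0, rfl⟩))
      (Submodule.smul_mem _ _ (Submodule.subset_span ⟨1, rfl⟩))
  have hli := linearIndependent_of_top_le_span_of_card_eq_finrank hspan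
    (by rw [RingOfIntegers.rank, hK, Fintype.card_fin])
  refine ⟨ω, Basis.mk hli hspan, by simp, ?_⟩
  apply RingOfIntegers.coe_injective
  simpa using hω

section PrimeNorm

variable {S : Type*} [CommRing S] [IsDedekindDomain S] [Module.Free ℤ S]

theorem intCast_mem_iff_of_absNorm_prime {p : ℕ} (hp : p.Prime) {I : Ideal S}
    (hI : absNorm I = p) (m : ℤ) : (m : S) ∈ I ↔ (p : ℤ) ∣ m := by
  have hpI : ((p : ℤ) : S) ∈ I := by
    have := absNorm_mem I
    rw [hI] at this
    exact_mod_cast this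
  constructor
  · intro hm
    by_contra hndvd
    obtain ⟨u, v, huv⟩ := ((Nat.prime_iff_prime_int.mp hp).coprime_iff_not_dvd.mpr hndvd)
    have h1 : (1 : S) ∈ I := by
      have h := congrArg (Int.cast : ℤ → S) huv
      push_cast at h hpI
      rw [← h]
      exact add_mem (I.mul_mem_left _ hpI) (I.mul_mem_left _ hm)
    rw [← eq_top_iff_one] at h1
    rw [h1, absNorm_top] at hI
    exact hp.one_lt.ne hI
  · rintro ⟨k, rfl⟩
    rw [Int.cast_mul]
    exact I.mul_mem_right _ hpI

theorem exists_sub_natCast_mem_of_absNorm_prime {p : ℕ} (hp : p.Prime) {I : Ideal S}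
    (hI : absNorm I = p) (z : S) : ∃ r : ℕ, r < p ∧ z - r ∈ I := by
  have : Fact p.Prime := ⟨hp⟩
  have hcard : Nat.card (S ⧸ I) = p := hI
  have hne : (1 : S ⧸ I) ≠ 0 := by
    have := (intCast_mem_iff_of_absNorm_prime hp hI 1).not.mpr
      (Nat.prime_iff_prime_int.mp hp).not_dvd_one
    rwa [Int.cast_one, ← Ideal.Quotient.eq_zero_iff_mem, map_one] at this
  obtain ⟨k, hk⟩ := AddSubgroup.mem_zmultiples_iff.mp
    (mem_zmultiples_of_prime_card hcard hne (g' := Ideal.Quotient.mk I z))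
  have hpos : (0 : ℤ) < p := by exact_mod_cast hp.pos
  have hmem : z - (k : S) ∈ I := by
    rw [← Ideal.Quotient.eq_zero_iff_mem, map_sub, ← hk]
    simp
  obtain ⟨r, hr⟩ := Int.eq_ofNat_of_zero_le (Int.emod_nonneg k hpos.ne')
  refine ⟨r, by have := Int.emod_lt_of_pos k hpos; omega, ?_⟩
  have hkr : ((k - r : ℤ) : S) ∈ I := by
    rw [intCast_mem_iff_of_absNorm_prime hp hI, ← hr]
    exact Int.dvd_self_sub_emod
  have := add_mem hmem hkr
  push_cast at this
  simpa using this

variable [Module.Finite ℤ S]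

/-- If `α ∈ I` has norm `absNorm I * q` up to sign, then `(α) = I * J` with `J` of norm `q`. -/
theorem exists_mul_eq_span_of_mem {I : Ideal S} {α : S} (hα : α ∈ I) {q : ℕ} (hI : absNorm I ≠ 0)
    (h : (Algebra.norm ℤ α).natAbs = absNorm I * q) :
    ∃ J : Ideal S, I * J = span {α} ∧ absNorm J = q := by
  obtain ⟨J, hJ⟩ := dvd_iff_le.mpr ((span_singleton_le_iff_mem I).mpr hα)
  refine ⟨J, hJ.symm, ?_⟩
  have := congrArg absNorm hJ
  rw [absNorm_span_singleton, map_mul, h] at this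
  exact (Nat.eq_of_mul_eq_mul_left (Nat.pos_of_ne_zero hI) this).symm

theorem eq_span_of_mem_of_absNorm_eq {I : Ideal S} {α : S} (hα : α ∈ I) (hI : absNorm I ≠ 0)
    (h : (Algebra.norm ℤ α).natAbs = absNorm I) : I = span {α} := by
  obtain ⟨J, hJ, hJ1⟩ := exists_mul_eq_span_of_mem hα hI (h.trans (mul_one _).symm)
  rw [absNorm_eq_one_iff] at hJ1
  rw [← hJ, hJ1, mul_top]

end PrimeNorm

section QuadraticOrder

variable {S : Type*} [CommRing S] {s n : ℤ} {ω : S} (b : Basis (Fin 2) ℤ S)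

theorem exists_eq_add_mul (hb : ⇑b = ![1, ω]) (z : S) : ∃ x y : ℤ, z = x + y * ω := by
  refine ⟨b.repr z 0, b.repr z 1, ?_⟩
  conv_lhs => rw [← b.sum_repr z]
  simp [Fin.sum_univ_two, hb]

theorem norm_add_mul (hb : ⇑b = ![1, ω])
    (hω : ω ^ 2 = algebraMap ℤ S s * ω - algebraMap ℤ S n) (x y : ℤ) :
    Algebra.norm ℤ ((x : S) + y * ω) = x ^ 2 + s * x * y + n * y ^ 2 := by
  simpa using norm_of_quadratic_basis b hb hω x y

variable [IsDedekindDomain S] [Module.Free ℤ S]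

theorem add_mul_mem_iff {p : ℕ} (hp : p.Prime) {I : Ideal S} (hI : absNorm I = p) {r : ℕ}
    (hr : ω - r ∈ I) (x y : ℤ) : (x : S) + y * ω ∈ I ↔ (p : ℤ) ∣ x + y * r := by
  have : (x : S) + y * ω = ((x + y * r : ℤ) : S) + y * (ω - r) := by push_cast; ring
  rw [← intCast_mem_iff_of_absNorm_prime hp hI, this,
    I.add_mem_iff_left (I.mul_mem_left (y : S) hr)]

variable [Module.Finite ℤ S]

/-- The residue of `ω` modulo an ideal of prime norm is a root of `X² - sX + n`. -/
theorem exists_root_of_absNorm_prime (hb : ⇑b = ![1, ω])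
    (hω : ω ^ 2 = algebraMap ℤ S s * ω - algebraMap ℤ S n) {p : ℕ} (hp : p.Prime) {I : Ideal S}
    (hI : absNorm I = p) :
    ∃ r : ℕ, r < p ∧ (p : ℤ) ∣ r ^ 2 - s * r + n ∧ ω - r ∈ I := by
  obtain ⟨r, hrp, hr⟩ := exists_sub_natCast_mem_of_absNorm_prime hp hI ω
  refine ⟨r, hrp, ?_, hr⟩
  have h := absNorm_dvd_norm_of_mem hr
  have hnorm := norm_add_mul b hb hω (-r) 1
  have : ((-r : ℤ) : S) + (1 : ℤ) * ω = ω - r := by push_cast; ring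
  rw [this] at hnorm
  rw [hI, hnorm] at h
  convert h using 1
  ring

/-- When `X² - sX + n` has at most one root modulo the prime `q`, there is at most one ideal of
norm `q`. -/
theorem eq_of_absNorm_eq_prime (hb : ⇑b = ![1, ω])
    (hω : ω ^ 2 = algebraMap ℤ S s * ω - algebraMap ℤ S n) {q t : ℕ} (hq : q.Prime)
    (hroot : ∀ r < q, (q : ℤ) ∣ r ^ 2 - s * r + n → r = t) {I J : Ideal S}
    (hI : absNorm I = q) (hJ : absNorm J = q) : I = J := by
  obtain ⟨r, hrq, hr, hrI⟩ := exists_root_of_absNorm_prime b hb hω hq hI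
  obtain ⟨r', hrq', hr', hrJ⟩ := exists_root_of_absNorm_prime b hb hω hq hJ
  obtain rfl := (hroot r hrq hr).trans (hroot r' hrq' hr').symm
  ext z
  obtain ⟨x, y, rfl⟩ := exists_eq_add_mul b hb z
  rw [add_mul_mem_iff hq hI hrI, add_mul_mem_iff hq hJ hrJ]

/-- If the norm of `ω - t` is divisible by the prime `q` exactly once, there is an ideal of norm
`q`. -/
theorem exists_absNorm_eq_prime (hb : ⇑b = ![1, ω])
    (hω : ω ^ 2 = algebraMap ℤ S s * ω - algebraMap ℤ S n) {q t : ℕ} (hq : q.Prime)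
    (hdvd : (q : ℤ) ∣ t ^ 2 - s * t + n) (hndvd : ¬ (q : ℤ) ^ 2 ∣ t ^ 2 - s * t + n) :
    ∃ I : Ideal S, absNorm I = q := by
  have hnorm : absNorm (span {ω - (t : S)}) = ((t : ℤ) ^ 2 - s * t + n).natAbs := by
    have h := norm_add_mul b hb hω (-t) 1
    have : ((-t : ℤ) : S) + (1 : ℤ) * ω = ω - t := by push_cast; ring
    rw [this] at h
    rw [absNorm_span_singleton, h]
    congr 1
    ring
  obtain ⟨P, hPmax, hPu, hPdvd⟩ := exists_isMaximal_dvd_of_dvd_absNorm' hq (span {ω - (t : S)})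
    (by rwa [hnorm, ← Int.natCast_dvd])
  obtain ⟨p, k, hk, hpP, hp, hPn⟩ := exists_prime_and_absNorm_eq_pow P
  have hpq : p = q := by
    have : (p : ℤ) ∈ P.under ℤ := by simpa [Ideal.mem_comap] using hpP
    rw [hPu, mem_span_singleton, Int.natCast_dvd_natCast] at this
    exact ((Nat.prime_dvd_prime_iff_eq hq hp).mp this).symm
  subst hpq
  refine ⟨P, ?_⟩
  have hk2 : k < 2 := by
    by_contra! h2
    apply hndvd
    have h := (pow_dvd_pow p h2).trans (hPn ▸ map_dvd absNorm hPdvd)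
    rw [hnorm, ← Int.natCast_dvd] at h
    exact_mod_cast h
  obtain rfl : k = 1 := by omega
  rw [hPn, pow_one]

end QuadraticOrder

/-- A Minkowski bound for quadratic fields, using only `3 < π`. -/
theorem exists_ideal_in_class_of_quadratic {K : Type*} [Field K] [NumberField K]
    (hK : finrank ℚ K = 2) (C : ClassGroup (𝓞 K)) :
    ∃ I : (Ideal (𝓞 K))⁰, ClassGroup.mk0 I = C ∧
      9 * (absNorm (I : Ideal (𝓞 K)) : ℤ) ^ 2 ≤ 4 * |discr K| := by
  obtain ⟨I, hIC, hI⟩ := exists_ideal_in_class_of_norm_le C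
  refine ⟨I, hIC, ?_⟩
  have hplaces := InfinitePlace.card_add_two_mul_card_eq_rank K
  rw [hK] at hplaces
  have hpi : (4 / Real.pi : ℝ) ^ InfinitePlace.nrComplexPlaces K ≤ 4 / 3 := by
    have h43 : 4 / Real.pi ≤ 4 / 3 := by
      gcongr
      exact Real.pi_gt_three.le
    obtain h | h : InfinitePlace.nrComplexPlaces K = 0 ∨ InfinitePlace.nrComplexPlaces K = 1 := by
      omega
    · rw [h]; norm_num
    · rwa [h, pow_one]
  rw [hK] at hI
  have hle : (absNorm (I : Ideal (𝓞 K)) : ℝ) ≤ 2 / 3 * √|(discr K : ℝ)| := by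
    refine hI.trans ?_
    calc
      _ ≤ 4 / 3 * (((Nat.factorial 2 : ℕ) : ℝ) / ((2 : ℕ) : ℝ) ^ 2 * √|(discr K : ℝ)|) := by gcongr
      _ = _ := by norm_num [Nat.factorial]; ring
  have hsq := pow_le_pow_left₀ (by positivity) hle 2
  rw [mul_pow, Real.sq_sqrt (abs_nonneg _)] at hsq
  have : 9 * (absNorm (I : Ideal (𝓞 K)) : ℝ) ^ 2 ≤ 4 * |(discr K : ℝ)| := by linarith
  exact_mod_cast this

/-- A subgroup of the class group containing the classes of all prime ideals whose norm satisfies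
`B` contains the classes of all ideals whose norm does, if `B` is inherited by divisors. -/
theorem mk0_mem_of_forall_isPrime {S : Type*} [CommRing S] [IsDedekindDomain S]
    [Module.Free ℤ S] [Module.Finite ℤ S] (H : Subgroup (ClassGroup S)) (B : ℕ → Prop)
    (hB : ∀ k m, k ∣ m → m ≠ 0 → B m → B k)
    (h : ∀ P : (Ideal S)⁰, (P : Ideal S).IsPrime → B (absNorm (P : Ideal S)) →
      ClassGroup.mk0 P ∈ H) (I : (Ideal S)⁰) (hI : B (absNorm (I : Ideal S))) :
    ClassGroup.mk0 I ∈ H := by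
  obtain ⟨I, hI0⟩ := I
  induction I using UniqueFactorizationMonoid.induction_on_prime with
  | h₁ => exact absurd rfl (nonZeroDivisors.ne_zero hI0)
  | h₂ I hu =>
    rw [Ideal.isUnit_iff] at hu
    subst hu
    rw [(ClassGroup.mk0_eq_one_iff hI0).mpr top_isPrincipal]
    exact one_mem H
  | h₃ I P hI' hP IH =>
    have hI0' := mem_nonZeroDivisors_of_ne_zero hI'
    have hP0 := mem_nonZeroDivisors_of_ne_zero hP.ne_zero
    have hne : absNorm (P * I) ≠ 0 := absNorm_ne_zero_of_nonZeroDivisors ⟨_, hI0⟩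
    have hmul : (⟨P * I, hI0⟩ : (Ideal S)⁰) = ⟨P, hP0⟩ * ⟨I, hI0'⟩ := rfl
    rw [hmul, map_mul]
    exact mul_mem (h _ (isPrime_of_prime hP) (hB _ _ (map_dvd absNorm (dvd_mul_right _ _)) hne hI))
      (IH hI0' (hB _ _ (map_dvd absNorm (dvd_mul_left _ _)) hne hI))

/-- Let `s² - 4n < 0` be a fundamental discriminant and `q` a small ramified prime. If every ideal
`(p, ω - r)` of norm `p` below the Minkowski bound contains an element of norm `p` or `p * q`,
then the class group is generated by the prime above `q` and has order two. -/
theorem classNumber_eq_two_of_quadratic {K : Type*} [Field K] [NumberField K]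
    (hK : finrank ℚ K = 2) {s n : ℤ} {q t : ℕ}
    (hfund : ∀ l : ℕ, (l : ℤ) ^ 2 ∣ 4 * n - s ^ 2 →
      l = 1 ∨ l = 2 ∧ s = 0 ∧ (n % 4 = 1 ∨ n % 4 = 2))
    (hx : ∃ x : K, x ^ 2 = ((s ^ 2 - 4 * n : ℤ) : K))
    (hq : q.Prime) (hqD : 4 * (q : ℤ) < 4 * n - s ^ 2)
    (hroot : ∀ r < q, (q : ℤ) ∣ r ^ 2 - s * r + n → r = t)
    (hdvd : (q : ℤ) ∣ t ^ 2 - s * t + n) (hndvd : ¬ (q : ℤ) ^ 2 ∣ t ^ 2 - s * t + n)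
    (hsmall : ∀ p : ℕ, 9 * (p : ℤ) ^ 2 ≤ 4 * (4 * n - s ^ 2) → ∀ r < p,
      (p : ℤ) ∣ r ^ 2 - s * r + n → ∃ x y : ℤ, (p : ℤ) ∣ x + y * r ∧
        (x ^ 2 + s * x * y + n * y ^ 2 = p ∨ x ^ 2 + s * x * y + n * y ^ 2 = p * q)) :
    classNumber K = 2 := by
  have hD : 0 < 4 * n - s ^ 2 := by omega
  obtain ⟨ω, b, hb, hω⟩ := exists_integral_basis_of_quadratic hK hD hfund hx
  have hdiscr : |discr K| = 4 * n - s ^ 2 := by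
    rw [← discr_eq_discr K b, discr_of_quadratic_basis b hb hω, abs_of_neg (by omega)]
    ring
  have hnorm := norm_add_mul b hb hω
  have huniq {I J : Ideal (𝓞 K)} := eq_of_absNorm_eq_prime b hb hω hq hroot (I := I) (J := J)
  obtain ⟨Q, hQ⟩ := exists_absNorm_eq_prime b hb hω hq hdvd hndvd
  have hQ0 : Q ∈ (Ideal (𝓞 K))⁰ :=
    absNorm_ne_zero_iff_mem_nonZeroDivisors.mp (hQ ▸ hq.ne_zero)
  have norm_natCast (p : ℕ) : (Algebra.norm ℤ (p : 𝓞 K)).natAbs = p ^ 2 := by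
    have := hnorm p 0
    simp only [Int.cast_natCast, Int.cast_zero, zero_mul, add_zero] at this
    rw [this]
    zify
    simp
  set c : ClassGroup (𝓞 K) := ClassGroup.mk0 ⟨Q, hQ0⟩ with hc
  have hcsq : c ^ 2 = 1 := by
    have hqQ : (q : 𝓞 K) ∈ Q := hQ ▸ absNorm_mem Q
    obtain ⟨J, hJ, hJq⟩ := exists_mul_eq_span_of_mem hqQ (q := q) (hQ ▸ hq.ne_zero)
      (by rw [norm_natCast, hQ, sq])
    rw [huniq hJq hQ] at hJ
    rw [sq, hc, ← map_mul]
    exact (ClassGroup.mk0_eq_one_iff _).mpr ⟨_, hJ⟩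
  have hcne : c ≠ 1 := by
    intro h1
    obtain ⟨z, hz⟩ := (ClassGroup.mk0_eq_one_iff hQ0).mp h1
    obtain ⟨x, y, rfl⟩ := exists_eq_add_mul b hb z
    rw [submodule_span_eq] at hz
    rw [hz, absNorm_span_singleton, hnorm] at hQ
    have hpos : 0 ≤ x ^ 2 + s * x * y + n * y ^ 2 := by
      nlinarith [sq_nonneg (2 * x + s * y), mul_nonneg hD.le (sq_nonneg y)]
    have hval : x ^ 2 + s * x * y + n * y ^ 2 = q := by omega
    have hy : y = 0 := by
      by_contra hy
      have : 0 < y ^ 2 := by positivity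
      nlinarith [sq_nonneg (2 * x + s * y)]
    subst hy
    have hxq : x.natAbs ^ 2 = q := by
      zify; rw [sq_abs]; linarith
    rw [← hxq] at hq
    exact Nat.Prime.not_prime_pow le_rfl hq
  have hprime : ∀ P : (Ideal (𝓞 K))⁰, (P : Ideal (𝓞 K)).IsPrime →
      9 * (absNorm (P : Ideal (𝓞 K)) : ℤ) ^ 2 ≤ 4 * (4 * n - s ^ 2) →
      ClassGroup.mk0 P ∈ Subgroup.zpowers c := by
    rintro ⟨P, hP0⟩ hP hPD
    have : P.IsMaximal := hP.isMaximal (nonZeroDivisors.ne_zero hP0)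
    have hPn : absNorm P ≠ 0 := absNorm_ne_zero_of_nonZeroDivisors ⟨P, hP0⟩
    obtain ⟨p, k, hk, hpP, hp, hPk⟩ := exists_prime_and_absNorm_eq_pow P
    have hk2 : k ≤ 2 := by
      have h := absNorm_dvd_norm_of_mem hpP
      rw [Int.natCast_dvd, norm_natCast, hPk] at h
      exact (Nat.pow_dvd_pow_iff_le_right hp.one_lt).mp h
    obtain rfl | rfl : k = 1 ∨ k = 2 := by omega
    · rw [pow_one] at hPk
      obtain ⟨r, hrp, hr, hrP⟩ := exists_root_of_absNorm_prime b hb hω hp hPk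
      obtain ⟨x, y, hxy, hval⟩ := hsmall p (by simpa [hPk] using hPD) r hrp hr
      have hmem := (add_mul_mem_iff hp hPk hrP x y).mpr hxy
      rcases hval with hval | hval
      · have hspan := eq_span_of_mem_of_absNorm_eq hmem hPn (by rw [hnorm, hval, hPk]; rfl)
        rw [(ClassGroup.mk0_eq_one_iff hP0).mpr ⟨_, hspan⟩]
        exact one_mem _
      · obtain ⟨J, hJ, hJq⟩ := exists_mul_eq_span_of_mem hmem (q := q) hPn
          (by rw [hnorm, hval, hPk]; exact_mod_cast Int.natAbs_natCast _)
        rw [huniq hJq hQ] at hJ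
        have hmul : ClassGroup.mk0 ⟨P, hP0⟩ * c = 1 := by
          rw [hc, ← map_mul]
          exact (ClassGroup.mk0_eq_one_iff _).mpr ⟨_, hJ⟩
        rw [eq_inv_of_mul_eq_one_left hmul]
        exact inv_mem (Subgroup.mem_zpowers c)
    · have hspan := eq_span_of_mem_of_absNorm_eq hpP hPn (by rw [norm_natCast, hPk])
      rw [(ClassGroup.mk0_eq_one_iff hP0).mpr ⟨_, hspan⟩]
      exact one_mem _
  have htop : ∀ C : ClassGroup (𝓞 K), C ∈ Subgroup.zpowers c := by
    intro C
    obtain ⟨I, rfl, hI⟩ := exists_ideal_in_class_of_quadratic hK C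
    rw [hdiscr] at hI
    refine mk0_mem_of_forall_isPrime _ (fun m ↦ 9 * (m : ℤ) ^ 2 ≤ 4 * (4 * n - s ^ 2))
      ?_ hprime I hI
    intro k m hkm hm h
    have : (k : ℤ) ≤ m := by exact_mod_cast Nat.le_of_dvd (Nat.pos_of_ne_zero hm) hkm
    nlinarith
  rw [classNumber, ← Nat.card_eq_fintype_card,
    ← orderOf_eq_card_of_forall_mem_zpowers htop]
  exact orderOf_eq_prime hcsq hcne

/-- A version of `classNumber_eq_two_of_quadratic` for discriminants of absolute value less than
`21²`, where all hypotheses can be checked by a bounded search. -/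
theorem classNumber_eq_two_of_quadratic_of_lt {K : Type*} [Field K] [NumberField K]
    (hK : finrank ℚ K = 2) {d : ℤ} (hx : ∃ x : K, x ^ 2 = (d : K)) (s n : ℤ) (q t : ℕ)
    (hq : q.Prime) (hd : d = s ^ 2 - 4 * n)
    (hqD : 4 * (q : ℤ) < 4 * n - s ^ 2) (hlt : 4 * n - s ^ 2 < 441)
    (hfund : ∀ l : ℕ, l < 21 → (l : ℤ) ^ 2 ∣ 4 * n - s ^ 2 →
      l = 1 ∨ l = 2 ∧ s = 0 ∧ (n % 4 = 1 ∨ n % 4 = 2))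
    (hroot : ∀ r < q, (q : ℤ) ∣ r ^ 2 - s * r + n → r = t)
    (hdvd : (q : ℤ) ∣ t ^ 2 - s * t + n) (hndvd : ¬ (q : ℤ) ^ 2 ∣ t ^ 2 - s * t + n)
    (hsmall : ∀ p : ℕ, p < 14 → 9 * (p : ℤ) ^ 2 ≤ 4 * (4 * n - s ^ 2) → ∀ r < p,
      (p : ℤ) ∣ r ^ 2 - s * r + n → ∃ x ∈ Finset.Icc (-13 : ℤ) 13, ∃ y ∈ Finset.Icc (0 : ℤ) 1,
        (p : ℤ) ∣ x + y * r ∧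
        (x ^ 2 + s * x * y + n * y ^ 2 = p ∨ x ^ 2 + s * x * y + n * y ^ 2 = p * q)) :
    classNumber K = 2 := by
  subst hd
  refine classNumber_eq_two_of_quadratic hK (fun l hl ↦ hfund l ?_ hl) hx hq hqD hroot hdvd hndvd
    fun p hp r hrp hr ↦ ?_
  · have := Int.le_of_dvd (by omega) hl
    zify
    nlinarith
  · obtain ⟨x, -, y, -, h⟩ := hsmall p (by zify; nlinarith) hp r hrp hr
    exact ⟨x, y, h⟩

set_option synthInstance.maxHeartbeats 400000 in
set_option synthInstance.maxSize 1000 in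
/-- For each `d` in the listed discriminants, the imaginary quadratic field `ℚ(√d)`
has class number 2. -/
theorem stmt_4 :
    ∀ d ∈ ({-15, -20, -24, -35, -40, -51, -52, -88, -91, -115, -123, -148, -187,
        -232, -267, -403, -427} : Finset ℤ),
      ∀ (K : Type) [Field K] [NumberField K],
        Module.finrank ℚ K = 2 → (∃ x : K, x ^ 2 = (d : K)) →
          NumberField.classNumber K = 2 := by
  intro d hd K _ _ hK hx
  simp only [Finset.mem_insert, Finset.mem_singleton] at hd
  have key := classNumber_eq_two_of_quadratic_of_lt hK hx
  rcases hd with rfl | rfl | rfl | rfl | rfl | rfl | rfl | rfl | rfl | rfl | rfl | rfl | rfl |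
    rfl | rfl | rfl | rfl
  · apply key 1 4 3 2 (by norm_num) <;> decide
  · apply key 0 5 2 1 (by norm_num) <;> decide
  · apply key 0 6 2 0 (by norm_num) <;> decide
  · apply key 1 9 5 3 (by norm_num) <;> decide
  · apply key 0 10 2 0 (by norm_num) <;> decide
  · apply key 1 13 3 2 (by norm_num) <;> decide
  · apply key 0 13 2 1 (by norm_num) <;> decide
  · apply key 0 22 2 0 (by norm_num) <;> decide
  · apply key 1 23 7 4 (by norm_num) <;> decide
  · apply key 1 29 5 3 (by norm_num) <;> decide
  · apply key 1 31 3 2 (by norm_num) <;> decide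
  · apply key 0 37 2 1 (by norm_num) <;> decide
  · apply key 1 47 11 6 (by norm_num) <;> decide
  · apply key 0 58 2 0 (by norm_num) <;> decide
  · apply key 1 67 3 2 (by norm_num) <;> decide
  · apply key 1 101 13 7 (by norm_num) <;> decide
  · apply key 1 107 7 4 (by norm_num) <;> decide
end

section
/- For each discriminant d in {-84, -120, -132, -168, -195, -228, -280, -312}, the class group of the imaginary quadratic field of discriminant d is isomorphic to Z/2Z × Z/2Z. -/
namespace QuadraticAlgebra

section Ideals

variable {r s : ℤ}

/-- The ideal of `ℤ[ω]` generated by an integer `a` and `b + ω`. -/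
def pairIdeal (r s a b : ℤ) : Ideal (QuadraticAlgebra ℤ r s) :=
  Ideal.span {(a : QuadraticAlgebra ℤ r s), ⟨b, 1⟩}

theorem pairIdeal_ne_bot (a b : ℤ) : pairIdeal r s a b ≠ ⊥ := by
  intro h
  have hmem : (⟨b, 1⟩ : QuadraticAlgebra ℤ r s) ∈ pairIdeal r s a b :=
    Ideal.subset_span (by simp)
  rw [h, Ideal.mem_bot] at hmem
  simpa using congrArg QuadraticAlgebra.im hmem

theorem pairIdeal_add_mul (a b k : ℤ) : pairIdeal r s a (b + k * a) = pairIdeal r s a b := by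
  have h : (⟨b + k * a, 1⟩ : QuadraticAlgebra ℤ r s) =
      ⟨b, 1⟩ + k * (a : QuadraticAlgebra ℤ r s) := by
    ext <;> simp
  rw [pairIdeal, h, Ideal.span_pair_add_mul_left, pairIdeal]

theorem pairIdeal_mul_conj {a b c u v w : ℤ} (h : b * b + s * b - r = a * c)
    (hg : u * a + v * (2 * b + s) + w * c = 1) :
    pairIdeal r s a b * pairIdeal r s a (-b - s) = Ideal.span {(a : QuadraticAlgebra ℤ r s)} := by
  rw [pairIdeal, pairIdeal, Ideal.span_pair_mul_span_pair]
  apply le_antisymm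
  · rw [Ideal.span_le]
    rintro x (rfl | rfl | rfl | rfl) <;>
      simp only [SetLike.mem_coe, Ideal.mem_span_singleton]
    · exact dvd_mul_right _ _
    · exact dvd_mul_right _ _
    · exact dvd_mul_left _ _
    · refine ⟨((-c : ℤ) : QuadraticAlgebra ℤ r s), ?_⟩
      ext <;> simp <;> linarith
  · rw [Ideal.span_singleton_le_iff_mem]
    have key : (a : QuadraticAlgebra ℤ r s) =
        u * ((a : QuadraticAlgebra ℤ r s) * a) + v * (⟨b, 1⟩ * a) - v * (a * ⟨-b - s, 1⟩)
          - w * (⟨b, 1⟩ * ⟨-b - s, 1⟩) := by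
      ext
      · simp
        linear_combination (-a) * hg - w * h
      · simp
        ring_nf
        simp
    refine (congrArg (· ∈ _) key).mpr ?_
    refine sub_mem (sub_mem (add_mem ?_ ?_) ?_) ?_ <;>
      exact Ideal.mul_mem_left _ _ (Ideal.subset_span (by
        simp only [Set.mem_insert_iff, Set.mem_singleton_iff, true_or, or_true]))

theorem pairIdeal_mul_swap {a b c u v w : ℤ} (h : b * b + s * b - r = a * c)
    (hg : u * a + v * (2 * b + s) + w * c = 1) :
    pairIdeal r s a b * pairIdeal r s c b =
      Ideal.span {(⟨b, 1⟩ : QuadraticAlgebra ℤ r s)} := by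
  rw [pairIdeal, pairIdeal, Ideal.span_pair_mul_span_pair]
  apply le_antisymm
  · rw [Ideal.span_le]
    rintro x (rfl | rfl | rfl | rfl) <;>
      simp only [SetLike.mem_coe, Ideal.mem_span_singleton]
    · refine ⟨⟨b + s, -1⟩, ?_⟩
      ext
      · simp
        linarith
      · simp
    · exact dvd_mul_left _ _
    · exact dvd_mul_right _ _
    · exact dvd_mul_right _ _
  · rw [Ideal.span_singleton_le_iff_mem]
    have key : (⟨b, 1⟩ : QuadraticAlgebra ℤ r s) =
        u * ((a : QuadraticAlgebra ℤ r s) * ⟨b, 1⟩) + v * (⟨b, 1⟩ * ⟨b, 1⟩) + v * (a * c)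
          + w * (⟨b, 1⟩ * c) := by
      ext
      · simp
        linear_combination (-b) * hg + v * h
      · simp
        linear_combination -hg
    refine (congrArg (· ∈ _) key).mpr ?_
    refine add_mem (add_mem (add_mem ?_ ?_) ?_) ?_ <;>
      exact Ideal.mul_mem_left _ _ (Ideal.subset_span (by
        simp only [Set.mem_insert_iff, Set.mem_singleton_iff, true_or, or_true]))

/-- Every nonzero ideal is an integer multiple of some `pairIdeal`. -/
theorem exists_eq_span_mul_pairIdeal (hneg : s * s + 4 * r < 0)
    {I : Ideal (QuadraticAlgebra ℤ r s)} (hI : I ≠ ⊥) :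
    ∃ m a b c : ℤ, m ≠ 0 ∧ 0 < a ∧ b * b + s * b - r = a * c ∧
      I = Ideal.span {(m : QuadraticAlgebra ℤ r s)} * pairIdeal r s a b := by
  let J : Ideal ℤ :=
    { carrier := {y | ∃ x, (⟨x, y⟩ : QuadraticAlgebra ℤ r s) ∈ I}
      add_mem' := by
        rintro y y' ⟨x, hx⟩ ⟨x', hx'⟩
        exact ⟨x + x', add_mem hx hx'⟩
      zero_mem' := ⟨0, I.zero_mem⟩
      smul_mem' := by
        rintro k y ⟨x, hx⟩
        refine ⟨k * x, ?_⟩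
        convert I.mul_mem_left (k : QuadraticAlgebra ℤ r s) hx using 1
        ext <;> simp }
  let G : Ideal ℤ := I.comap (Int.castRingHom _)
  obtain ⟨m, hm⟩ := (IsPrincipalIdealRing.principal J).principal
  obtain ⟨g, hg⟩ := (IsPrincipalIdealRing.principal G).principal
  have hJ : ∀ y, (∃ x, (⟨x, y⟩ : QuadraticAlgebra ℤ r s) ∈ I) ↔ m ∣ y := fun y ↦ by
    rw [← Ideal.mem_span_singleton]; exact (SetLike.ext_iff.mp hm y)
  have hG : ∀ y : ℤ, (y : QuadraticAlgebra ℤ r s) ∈ I ↔ g ∣ y := fun y ↦ by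
    rw [← Ideal.mem_span_singleton]; exact (SetLike.ext_iff.mp hg y)
  have hom : ∀ x y : ℤ, (⟨x, y⟩ : QuadraticAlgebra ℤ r s) ∈ I → m ∣ x ∧ m ∣ y := by
    intro x y hxy
    have h1 := (hJ y).1 ⟨x, hxy⟩
    have h2 := (hJ (x + s * y)).1 ⟨r * y, by
      convert I.mul_mem_left (⟨0, 1⟩ : QuadraticAlgebra ℤ r s) hxy using 1
      ext <;> simp⟩
    exact ⟨(dvd_add_left (h1.mul_left s)).1 h2, h1⟩
  have hm0 : m ≠ 0 := by
    rintro rfl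
    refine hI ((Submodule.eq_bot_iff I).2 fun ⟨x, y⟩ hx ↦ ?_)
    obtain ⟨h1, h2⟩ := hom x y hx
    rw [zero_dvd_iff] at h1 h2
    subst h1 h2
    rfl
  obtain ⟨x₀, hx₀⟩ := (hJ m).2 dvd_rfl
  obtain ⟨b, rfl⟩ := (hom _ _ hx₀).1
  have hgI : (⟨g, 0⟩ : QuadraticAlgebra ℤ r s) ∈ I := (hG g).2 dvd_rfl
  obtain ⟨a, rfl⟩ := (hom _ _ hgI).1
  have hN : m * a ∣ m * (b * b + s * b - r) := by
    rw [← hG]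
    convert I.mul_mem_left (⟨b + s, -1⟩ : QuadraticAlgebra ℤ r s) hx₀ using 1
    ext <;> simp <;> ring
  obtain ⟨c, hc⟩ := (mul_dvd_mul_iff_left hm0).1 hN
  have ha0 : a ≠ 0 := by
    rintro rfl
    nlinarith [sq_nonneg (2 * b + s)]
  have hI' : I = Ideal.span {(m : QuadraticAlgebra ℤ r s)} * pairIdeal r s a b := by
    rw [pairIdeal, Ideal.span_mul_span', Set.singleton_mul, Set.image_pair]
    apply le_antisymm
    · rintro ⟨x, y⟩ hxy
      obtain ⟨k, rfl⟩ := (hom x y hxy).2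
      have h2 : ((x - k * (m * b) : ℤ) : QuadraticAlgebra ℤ r s) ∈ I := by
        convert I.sub_mem hxy (I.mul_mem_left (k : QuadraticAlgebra ℤ r s) hx₀) using 1
        ext <;> simp
        ring
      obtain ⟨l, hl⟩ := (hG _).1 h2
      rw [Ideal.mem_span_pair]
      refine ⟨l, k, ?_⟩
      ext
      · simp
        linear_combination -hl
      · simp
        ring
    · rw [Ideal.span_le]
      rintro x (rfl | rfl)
      · have h1 : (m : QuadraticAlgebra ℤ r s) * a = ⟨m * a, 0⟩ := by ext <;> simp
        exact h1 ▸ hgI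
      · have h1 : (m : QuadraticAlgebra ℤ r s) * ⟨b, 1⟩ = ⟨m * b, m⟩ := by ext <;> simp
        exact h1 ▸ hx₀
  rcases lt_or_gt_of_ne ha0 with h | h
  · refine ⟨m, -a, b, -c, hm0, by linarith, by linarith, ?_⟩
    rw [hI', pairIdeal, pairIdeal, Int.cast_neg, Ideal.span_insert, Ideal.span_insert,
      Ideal.span_singleton_neg]
  · exact ⟨m, a, b, c, hm0, h, hc, hI'⟩

/-- If `(x)² = (q)` for a positive integer `q`, then the norm of `x` is `q`. -/
theorem norm_eq_of_span_mul_span_eq (hneg : s * s + 4 * r < 0) {x : QuadraticAlgebra ℤ r s} {q : ℤ}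
    (hq : 0 < q)
    (h : Ideal.span {x} * Ideal.span {x} = Ideal.span {(q : QuadraticAlgebra ℤ r s)}) :
    norm x = q := by
  rw [Ideal.span_singleton_mul_span_singleton] at h
  have h1 := map_dvd norm (Ideal.span_singleton_le_span_singleton.1 h.le)
  have h2 := map_dvd norm (Ideal.span_singleton_le_span_singleton.1 h.ge)
  rw [map_mul, norm_intCast, ← sq] at h1 h2
  have hx : 0 ≤ norm x := by
    rw [norm_def]
    nlinarith [sq_nonneg (2 * x.re + s * x.im), sq_nonneg x.im,
      mul_nonneg (neg_nonneg.2 hneg.le) (sq_nonneg x.im)]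
  exact (pow_left_inj₀ hx hq.le two_ne_zero).1
    (Int.dvd_antisymm (sq_nonneg _) (sq_nonneg _) h2 h1)

/-- Primitivity of all forms of the given discriminant gives a Bezout relation. -/
theorem exists_bezout
    (hprim : ∀ g t a c : ℤ, g * g * (t * t - 4 * a * c) = s * s + 4 * r → IsUnit g)
    {a b c : ℤ} (h : b * b + s * b - r = a * c) :
    ∃ u v w : ℤ, u * a + v * (2 * b + s) + w * c = 1 := by
  obtain ⟨g, hg⟩ := (IsPrincipalIdealRing.principal (Ideal.span {a, 2 * b + s, c})).principal
  have hdvd : ∀ x ∈ ({a, 2 * b + s, c} : Set ℤ), g ∣ x := fun x hx ↦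
    Ideal.mem_span_singleton.1 (hg.le (Ideal.subset_span hx))
  obtain ⟨a', rfl⟩ := hdvd a (by simp)
  obtain ⟨t, ht⟩ := hdvd (2 * b + s) (by simp)
  obtain ⟨c', rfl⟩ := hdvd c (by simp)
  have hunit := hprim g t a' c' (by linear_combination (-(2 * b + s) - g * t) * ht + 4 * h)
  have htop : (1 : ℤ) ∈ Ideal.span {g * a', 2 * b + s, g * c'} := by
    rw [hg]
    exact Ideal.mem_span_singleton.2 hunit.dvd
  obtain ⟨u, v, w, huvw⟩ := Submodule.mem_span_triple.1 htop
  exact ⟨u, v, w, by simpa using huvw⟩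

theorem not_isPrincipal_of_mul_self_eq (hneg : s * s + 4 * r < 0) {q : ℤ} (hq : 0 < q)
    (hlt : 4 * q < -(s * s + 4 * r)) (hsq : ¬ IsSquare q) {I : Ideal (QuadraticAlgebra ℤ r s)}
    (h : I * I = Ideal.span {(q : QuadraticAlgebra ℤ r s)}) : ¬ I.IsPrincipal := by
  rintro ⟨x, rfl⟩
  have hx := norm_eq_of_span_mul_span_eq hneg hq h
  rw [norm_def] at hx
  have him : x.im = 0 := by
    by_contra him
    have h1 : 1 ≤ x.im ^ 2 := by
      have := sq_pos_of_ne_zero him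
      linarith
    nlinarith [sq_nonneg (2 * x.re + s * x.im)]
  rw [him] at hx
  exact hsq ⟨x.re, by linarith⟩

/-- The reduced pairs in the range relevant for discriminants of absolute value less than `324`. -/
noncomputable def reducedPairs (r s : ℤ) : Finset (ℤ × ℤ) :=
  {p ∈ Finset.Icc (1 : ℤ) 10 ×ˢ Finset.Icc (-1 : ℤ) 5 |
    0 ≤ 2 * p.2 + s ∧ 2 * p.2 + s ≤ p.1 ∧ p.1 ∣ p.2 * p.2 + s * p.2 - r ∧
      p.1 * p.1 ≤ p.2 * p.2 + s * p.2 - r}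

theorem isUnit_of_mul_self_mul_eq (hneg : s * s + 4 * r < 0) (hbound : -324 < s * s + 4 * r)
    (hfund : ∀ g ∈ Finset.Icc (2 : ℤ) 17, g * g ∣ s * s + 4 * r →
      1 < (s * s + 4 * r) / (g * g) % 4)
    (g t a c : ℤ) (h : g * g * (t * t - 4 * a * c) = s * s + 4 * r) : IsUnit g := by
  wlog hg : 0 ≤ g generalizing g
  · rw [← IsUnit.neg_iff]
    exact this (-g) (by linear_combination h) (by linarith)
  have hg0 : g ≠ 0 := by
    rintro rfl
    linarith
  have hg1 : 0 < g := lt_of_le_of_ne hg hg0.symm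
  rcases eq_or_lt_of_le (show 1 ≤ g by linarith) with h1 | h1
  · simp [← h1]
  exfalso
  have hlt : t * t - 4 * a * c < 0 := by
    by_contra! hcon
    nlinarith [mul_nonneg (mul_self_nonneg g) hcon]
  have hg17 : g ≤ 17 := by
    by_contra! hcon
    nlinarith
  have := hfund g (Finset.mem_Icc.2 ⟨h1, hg17⟩) ⟨_, h.symm⟩
  rw [← h, Int.mul_ediv_cancel_left _ (mul_ne_zero hg0 hg0), mul_assoc] at this
  have h2 : t * t % 4 = 0 ∨ t * t % 4 = 1 := by
    rcases Int.even_or_odd' t with ⟨m, rfl | rfl⟩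
    · left; ring_nf; omega
    · right; ring_nf; omega
  omega

end Ideals

section ClassGroup

variable {r s : ℤ} [IsDedekindDomain (QuadraticAlgebra ℤ r s)]

/-- The ideal class of `pairIdeal r s a b`. -/
noncomputable def pairClass (r s : ℤ)
    [IsDedekindDomain (QuadraticAlgebra ℤ r s)] (a b : ℤ) : ClassGroup (QuadraticAlgebra ℤ r s) :=
  ClassGroup.mk0 ⟨pairIdeal r s a b, mem_nonZeroDivisors_of_ne_zero (pairIdeal_ne_bot a b)⟩

theorem pairClass_add_mul (a b k : ℤ) : pairClass r s a (b + k * a) = pairClass r s a b := by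
  simp only [pairClass, pairIdeal_add_mul]

theorem pairClass_mul_eq_one_iff (a b a' b' : ℤ) :
    pairClass r s a b * pairClass r s a' b' = 1 ↔
      (pairIdeal r s a b * pairIdeal r s a' b').IsPrincipal := by
  rw [pairClass, pairClass, ← map_mul, ← ClassGroup.mk0_eq_one_iff]
  rfl

theorem exists_eq_pairClass (hneg : s * s + 4 * r < 0) (C : ClassGroup (QuadraticAlgebra ℤ r s)) :
    ∃ a b c : ℤ, 0 < a ∧ b * b + s * b - r = a * c ∧ C = pairClass r s a b := by
  obtain ⟨⟨I, hI⟩, rfl⟩ := ClassGroup.mk0_surjective C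
  obtain ⟨m, a, b, c, hm, ha, hc, h⟩ :=
    exists_eq_span_mul_pairIdeal hneg (nonZeroDivisors.ne_zero hI)
  refine ⟨a, b, c, ha, hc, ClassGroup.mk0_eq_mk0_iff.2 ⟨1, m, one_ne_zero, by simpa using hm, ?_⟩⟩
  simpa using h

theorem pairClass_mul_self_eq_one
    (hprim : ∀ g t a c : ℤ, g * g * (t * t - 4 * a * c) = s * s + 4 * r → IsUnit g)
    {a b c : ℤ} (h : b * b + s * b - r = a * c) (hamb : a ∣ 2 * b + s ∨ a = c) :
    pairClass r s a b * pairClass r s a b = 1 := by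
  obtain ⟨u, v, w, hg⟩ := exists_bezout hprim h
  rw [pairClass_mul_eq_one_iff]
  rcases hamb with ⟨k, hk⟩ | rfl
  · have hb : -b - s = b + (-k) * a := by linear_combination -hk
    have := pairIdeal_mul_conj h hg
    rw [hb, pairIdeal_add_mul] at this
    exact ⟨_, this⟩
  · exact ⟨_, pairIdeal_mul_swap h hg⟩

/-- Gauss reduction: every ideal class is, up to inversion, that of a reduced form. -/
theorem exists_reduced_pairClass (hneg : s * s + 4 * r < 0)
    (hprim : ∀ g t a c : ℤ, g * g * (t * t - 4 * a * c) = s * s + 4 * r → IsUnit g)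
    (C : ClassGroup (QuadraticAlgebra ℤ r s)) :
    ∃ a b c : ℤ, 0 ≤ 2 * b + s ∧ 2 * b + s ≤ a ∧ 0 < a ∧ a ≤ c ∧ b * b + s * b - r = a * c ∧
      (C = pairClass r s a b ∨ C⁻¹ = pairClass r s a b) := by
  let P : ℕ → Prop := fun k ↦ 0 < k ∧ ∃ b c : ℤ, b * b + s * b - r = k * c ∧
      (C = pairClass r s k b ∨ C⁻¹ = pairClass r s k b)
  have hP : ∃ k, P k := by
    obtain ⟨a, b, c, ha, hc, h⟩ := exists_eq_pairClass hneg C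
    lift a to ℕ using ha.le
    exact ⟨a, by exact_mod_cast ha, b, c, hc, Or.inl h⟩
  classical
  obtain ⟨hk, b₀, c₀, h₀, hC₀⟩ := Nat.find_spec hP
  have hmin : ∀ m, P m → Nat.find hP ≤ m := fun m ↦ Nat.find_min' hP
  generalize Nat.find hP = k at *
  have hk' : (0 : ℤ) < k := by exact_mod_cast hk
  -- translate `b₀` so that `|2 b + s| ≤ k`, then use the symmetry `b ↦ -b - s`
  obtain ⟨b, c, hb1, hb2, hc, hC⟩ : ∃ b c : ℤ, 0 ≤ 2 * b + s ∧ 2 * b + s ≤ k ∧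
      b * b + s * b - r = k * c ∧ (C = pairClass r s k b ∨ C⁻¹ = pairClass r s k b) := by
    obtain ⟨b₁, c₁, hl, hu, h₁, hC₁⟩ : ∃ b c : ℤ, -k ≤ 2 * b + s ∧ 2 * b + s ≤ k ∧
        b * b + s * b - r = k * c ∧ (C = pairClass r s k b ∨ C⁻¹ = pairClass r s k b) := by
      let l := (2 * b₀ + s + k) / (2 * k)
      have hl := Int.emod_add_mul_ediv (2 * b₀ + s + k) (2 * k)
      have hl1 := Int.emod_nonneg (2 * b₀ + s + k) (b := 2 * k) (by linarith)
      have hl2 := Int.emod_lt_of_pos (2 * b₀ + s + k) (b := 2 * k) (by linarith)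
      have hl' : (2 * b₀ + s + k) % (2 * k) + 2 * (l * k) = 2 * b₀ + s + k := by
        linear_combination hl
      refine ⟨b₀ + (-l) * k, c₀ - 2 * l * b₀ + l * l * k - s * l, by linarith, by linarith,
        by linear_combination h₀, ?_⟩
      rwa [pairClass_add_mul]
    rcases le_or_gt 0 (2 * b₁ + s) with h | h
    · exact ⟨b₁, c₁, h, hu, h₁, hC₁⟩
    · refine ⟨-b₁ - s, c₁, by linarith, by linarith, by linear_combination h₁, ?_⟩
      obtain ⟨u, v, w, hg⟩ := exists_bezout hprim h₁
      have hmul : pairClass r s k b₁ * pairClass r s k (-b₁ - s) = 1 :=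
        (pairClass_mul_eq_one_iff ..).2 ⟨_, pairIdeal_mul_conj h₁ hg⟩
      rw [← inv_eq_iff_mul_eq_one] at hmul
      rw [← hmul]
      rcases hC₁ with h | h
      · exact Or.inr (by rw [h])
      · exact Or.inl (by rw [← h, inv_inv])
  refine ⟨k, b, c, hb1, hb2, hk', ?_, hc, hC⟩
  have hc0 : 0 < c := by
    by_contra! hcon
    nlinarith [sq_nonneg (2 * b + s)]
  lift c to ℕ using hc0.le
  refine Int.ofNat_le.2 (hmin c ⟨by exact_mod_cast hc0, b, k, by linear_combination hc, ?_⟩)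
  obtain ⟨u, v, w, hg⟩ := exists_bezout hprim hc
  have hmul : pairClass r s k b * pairClass r s c b = 1 :=
    (pairClass_mul_eq_one_iff ..).2 ⟨_, pairIdeal_mul_swap hc hg⟩
  rw [← inv_eq_iff_mul_eq_one] at hmul
  rw [← hmul]
  rcases hC with h | h
  · exact Or.inr (by rw [h])
  · exact Or.inl (by rw [← h, inv_inv])

/-- A criterion for the class group of a quadratic order to be a Klein four-group: the reduced
forms are at most four and ambiguous, and two ambiguous ideals of small norms generate a subgroup
of order four. -/
theorem isKleinFour_classGroup (q₁ b₁ q₂ b₂ : ℤ) (hs : s = 0 ∨ s = 1) (hneg : s * s + 4 * r < 0)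
    (hbound : -324 < s * s + 4 * r)
    (hfund : ∀ g ∈ Finset.Icc (2 : ℤ) 17, g * g ∣ s * s + 4 * r →
      1 < (s * s + 4 * r) / (g * g) % 4)
    (hcard : (reducedPairs r s).card ≤ 4)
    (hamb : ∀ p ∈ reducedPairs r s,
      p.1 ∣ 2 * p.2 + s ∨ p.1 * p.1 = p.2 * p.2 + s * p.2 - r)
    (hq₁ : 0 < q₁) (hq₂ : 0 < q₂)
    (hb₁ : q₁ ∣ 2 * b₁ + s) (hb₂ : q₂ ∣ 2 * b₂ + s)
    (hc₁ : q₁ ∣ b₁ * b₁ + s * b₁ - r) (hc₂ : q₂ ∣ b₂ * b₂ + s * b₂ - r)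
    (hlt : 4 * (q₁ * q₂) < -(s * s + 4 * r))
    (hsq₁ : ¬ IsSquare q₁) (hsq₂ : ¬ IsSquare q₂) (hsq : ¬ IsSquare (q₁ * q₂)) :
    IsKleinFour (ClassGroup (QuadraticAlgebra ℤ r s)) := by
  have hprim := isUnit_of_mul_self_mul_eq hneg hbound hfund
  have hreduced (C : ClassGroup (QuadraticAlgebra ℤ r s)) :
      C * C = 1 ∧ ∃ p : reducedPairs r s, pairClass r s p.1.1 p.1.2 = C := by
    obtain ⟨a, b, c, h0, hba, ha, hac, hc, hC⟩ := exists_reduced_pairClass hneg hprim C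
    have ha10 : a ≤ 10 := by
      by_contra! hcon
      nlinarith
    have hmem : (a, b) ∈ reducedPairs r s := by
      simp only [reducedPairs, Finset.mem_filter, Finset.mem_product, Finset.mem_Icc]
      refine ⟨⟨⟨ha, ha10⟩, by omega, by omega⟩, h0, hba, ⟨c, hc⟩, ?_⟩
      rw [hc]
      exact mul_le_mul_of_nonneg_left hac ha.le
    have hself : pairClass r s a b * pairClass r s a b = 1 := by
      refine pairClass_mul_self_eq_one hprim hc ((hamb _ hmem).imp_right fun h ↦ ?_)
      exact mul_left_cancel₀ ha.ne' (h.trans hc)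
    have hCeq : C = pairClass r s a b := by
      rcases hC with h | h
      · exact h
      · rw [← inv_inj, h, eq_inv_iff_mul_eq_one, hself]
    exact ⟨hCeq ▸ hself, ⟨(a, b), hmem⟩, hCeq.symm⟩
  have hsurj : Function.Surjective
      (fun p : reducedPairs r s ↦ pairClass r s p.1.1 p.1.2) := fun C ↦ (hreduced C).2
  have hfin : Finite (ClassGroup (QuadraticAlgebra ℤ r s)) := Finite.of_surjective _ hsurj
  have hle : Nat.card (ClassGroup (QuadraticAlgebra ℤ r s)) ≤ 4 :=
    (Nat.card_le_card_of_surjective _ hsurj).trans (by simpa using hcard)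
  have hideal {q b : ℤ} (hb : q ∣ 2 * b + s) (hc : q ∣ b * b + s * b - r) :
      pairIdeal r s q b * pairIdeal r s q b = Ideal.span {(q : QuadraticAlgebra ℤ r s)} := by
    obtain ⟨c, hc⟩ := hc
    obtain ⟨k, hk⟩ := hb
    obtain ⟨u, v, w, hg⟩ := exists_bezout hprim hc
    have h := pairIdeal_mul_conj hc hg
    rwa [show -b - s = b + (-k) * q by linear_combination -hk, pairIdeal_add_mul] at h
  have hne {q b : ℤ} (hq : 0 < q) (hlt : 4 * q < -(s * s + 4 * r)) (hsq : ¬ IsSquare q)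
      (hb : q ∣ 2 * b + s) (hc : q ∣ b * b + s * b - r) : pairClass r s q b ≠ 1 := fun h ↦
    not_isPrincipal_of_mul_self_eq hneg hq hlt hsq (hideal hb hc)
      ((ClassGroup.mk0_eq_one_iff _).1 h)
  have hne₁ := hne hq₁ (by nlinarith) hsq₁ hb₁ hc₁
  have hne₂ := hne hq₂ (by nlinarith) hsq₂ hb₂ hc₂
  have hne₁₂ : pairClass r s q₁ b₁ * pairClass r s q₂ b₂ ≠ 1 := fun h ↦ by
    refine not_isPrincipal_of_mul_self_eq hneg (mul_pos hq₁ hq₂) hlt hsq ?_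
      ((pairClass_mul_eq_one_iff ..).1 h)
    rw [mul_mul_mul_comm, hideal hb₁ hc₁, hideal hb₂ hc₂, Ideal.span_singleton_mul_span_singleton,
      Int.cast_mul]
  generalize pairClass r s q₁ b₁ = x at hne₁ hne₁₂
  generalize pairClass r s q₂ b₂ = y at hne₂ hne₁₂
  have hge : 4 ≤ Nat.card (ClassGroup (QuadraticAlgebra ℤ r s)) := by
    classical
    have := Fintype.ofFinite (ClassGroup (QuadraticAlgebra ℤ r s))
    have hxy : x ≠ y := fun h ↦ hne₁₂ (h ▸ (hreduced x).1)
    have hfour : ({1, x, y, x * y} : Finset (ClassGroup (QuadraticAlgebra ℤ r s))).card = 4 := by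
      simp [Finset.card_insert_of_notMem, hne₁.symm, hne₂.symm, hne₁₂.symm, hxy, hne₁, hne₂]
    rw [Nat.card_eq_fintype_card, ← hfour]
    exact Finset.card_le_univ _
  refine ⟨le_antisymm hle hge, ?_⟩
  have hexp : Monoid.exponent (ClassGroup (QuadraticAlgebra ℤ r s)) ∣ 2 :=
    Monoid.exponent_dvd_of_forall_pow_eq_one fun C ↦ by rw [sq, (hreduced C).1]
  refine ((Nat.dvd_prime Nat.prime_two).1 hexp).resolve_left fun h ↦ hne₁ ?_
  simpa [h] using Monoid.pow_exponent_eq_one x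

end ClassGroup

end QuadraticAlgebra

namespace NumberField

open QuadraticAlgebra

variable {K : Type*} [Field K] [NumberField K]

/-- The ring of integers of a quadratic field has an integral basis of the form `1, ω`. -/
theorem exists_basis_one_of_finrank_eq_two (h : Module.finrank ℚ K = 2) :
    ∃ b : Module.Basis (Fin 2) ℤ (𝓞 K), b 0 = 1 := by
  have hrank : Module.finrank ℤ (𝓞 K) = 2 := by rw [RingOfIntegers.rank, h]
  let e := Module.finBasisOfFinrankEq ℤ (𝓞 K) hrank
  set u := e.repr 1 0
  set v := e.repr 1 1
  have huv : u • e 0 + v • e 1 = 1 := by simpa [Fin.sum_univ_two] using e.sum_repr 1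
  have hcop : IsCoprime u v := by
    obtain ⟨g, hg⟩ := (IsPrincipalIdealRing.principal (Ideal.span {u, v})).principal
    have hdvd : ∀ x ∈ ({u, v} : Set ℤ), g ∣ x := fun x hx ↦
      Ideal.mem_span_singleton.1 (hg.le (Ideal.subset_span hx))
    obtain ⟨u', hu'⟩ := hdvd u (by simp)
    obtain ⟨v', hv'⟩ := hdvd v (by simp)
    have hone : g • (u' • e 0 + v' • e 1) = 1 := by
      rw [smul_add, smul_smul, smul_smul, ← hu', ← hv', huv]
    have hunit : IsUnit g := by
      refine isUnit_of_dvd_one ⟨e.repr ((u' • e 0 + v' • e 1) * e 0) 0, ?_⟩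
      have h0 : e.repr (g • ((u' • e 0 + v' • e 1) * e 0)) 0 = 1 := by
        rw [← smul_mul_assoc, hone, one_mul]
        simp
      rw [← h0, map_smul, Finsupp.smul_apply, smul_eq_mul]
    have hmem : (1 : ℤ) ∈ Ideal.span {u, v} := by
      rw [hg]
      exact Ideal.mem_span_singleton.2 hunit.dvd
    exact Ideal.mem_span_pair.1 hmem
  obtain ⟨p, q, hpq⟩ := hcop
  let f : Fin 2 → 𝓞 K := ![1, -q • e 0 + p • e 1]
  have hspan : ⊤ ≤ Submodule.span ℤ (Set.range f) := by
    rw [← e.span_eq, Submodule.span_le]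
    have hf (i : Fin 2) : f i ∈ Submodule.span ℤ (Set.range f) :=
      Submodule.subset_span ⟨i, rfl⟩
    rintro _ ⟨i, rfl⟩
    fin_cases i
    · have h0 : e 0 = p • f 0 - v • f 1 := by
        simp only [f, Matrix.cons_val_zero, Matrix.cons_val_one, ← huv, smul_add, smul_smul]
        match_scalars
        · linear_combination -hpq
        · ring
      exact h0 ▸ sub_mem (Submodule.smul_mem _ _ (hf 0)) (Submodule.smul_mem _ _ (hf 1))
    · have h1 : e 1 = q • f 0 + u • f 1 := by
        simp only [f, Matrix.cons_val_zero, Matrix.cons_val_one, ← huv, smul_add, smul_smul]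
        match_scalars
        · linear_combination -hpq
        · ring
      exact h1 ▸ add_mem (Submodule.smul_mem _ _ (hf 0)) (Submodule.smul_mem _ _ (hf 1))
  refine ⟨basisOfTopLeSpanOfCardEqFinrank f hspan (by simp [hrank]), by simp [f]⟩

/-- A quadratic field of discriminant `s ^ 2 + 4 r` has ring of integers `ℤ[ω]` with
`ω ^ 2 = r + s ω`. -/
theorem nonempty_ringEquiv_quadraticAlgebra (h : Module.finrank ℚ K = 2) {r s : ℤ}
    (hd : discr K = s * s + 4 * r) : Nonempty (QuadraticAlgebra ℤ r s ≃+* 𝓞 K) := by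
  obtain ⟨b, hb⟩ := exists_basis_one_of_finrank_eq_two h
  obtain ⟨r₀, s₀, hω₀⟩ : ∃ r₀ s₀ : ℤ, b 1 * b 1 = r₀ • b 0 + s₀ • b 1 :=
    ⟨_, _, by simpa [Fin.sum_univ_two] using (b.sum_repr (b 1 * b 1)).symm⟩
  have htr (x : 𝓞 K) : Algebra.trace ℤ (𝓞 K) x = b.repr x 0 + b.repr (x * b 1) 1 := by
    rw [Algebra.trace_eq_matrix_trace b, Matrix.trace_fin_two,
      Algebra.leftMulMatrix_eq_repr_mul, Algebra.leftMulMatrix_eq_repr_mul, hb, mul_one]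
  have htr_one : Algebra.trace ℤ (𝓞 K) (b 0) = 2 := by
    rw [htr, hb, one_mul, ← hb]
    simp
  have htr_ω₀ : Algebra.trace ℤ (𝓞 K) (b 1) = s₀ := by
    rw [htr, hω₀]
    simp [-zsmul_eq_mul]
  have hdisc : s₀ * s₀ + 4 * r₀ = s * s + 4 * r := by
    rw [← hd, ← discr_eq_discr K b, Algebra.discr_def, Matrix.det_fin_two]
    simp only [Algebra.traceMatrix_apply, Algebra.traceForm_apply, hω₀, map_add, map_smul,
      htr_ω₀, htr_one, smul_eq_mul]
    rw [hb, one_mul, one_mul, mul_one, htr_ω₀, ← hb, htr_one]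
    ring
  obtain ⟨k, hk⟩ : ∃ k, s₀ = s + 2 * k := by
    have h1 : Even (s₀ * s₀ - s * s) := ⟨2 * (r - r₀), by linear_combination hdisc⟩
    have h2 : Even (s₀ - s) := by
      rw [Int.even_sub, Int.even_mul, Int.even_mul] at h1
      rw [Int.even_sub]
      tauto
    obtain ⟨k, hk⟩ := h2
    exact ⟨k, by linarith⟩
  have hr : r = r₀ + k * k + s * k := by
    subst hk
    linarith
  have hω : (b 1 - k • b 0) * (b 1 - k • b 0) = r • 1 + s • (b 1 - k • b 0) := by
    have hexp : (b 1 - k • b 0) * (b 1 - k • b 0) =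
        b 1 * b 1 - (2 * k) • b 1 + (k * k) • b 0 := by
      rw [hb]
      simp only [zsmul_eq_mul]
      push_cast
      ring
    rw [hexp, hω₀, ← hb, hr, hk]
    module
  let φ : QuadraticAlgebra ℤ r s →ₐ[ℤ] 𝓞 K := QuadraticAlgebra.lift ⟨b 1 - k • b 0, hω⟩
  have hφ (z : QuadraticAlgebra ℤ r s) : φ z = (z.re - k * z.im) • b 0 + z.im • b 1 := by
    have : φ z = z.re • b 0 + z.im • (b 1 - k • b 0) := by
      simp [φ, QuadraticAlgebra.lift, hb]
    rw [this]
    module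
  refine ⟨RingEquiv.ofBijective φ ⟨fun z w hzw ↦ ?_, fun x ↦ ?_⟩⟩
  · rw [hφ, hφ] at hzw
    have h0 := congrArg (fun x ↦ b.repr x 0) hzw
    have h1 := congrArg (fun x ↦ b.repr x 1) hzw
    simp [-zsmul_eq_mul] at h0 h1
    rw [h1] at h0
    exact QuadraticAlgebra.ext (by linarith) h1
  · refine ⟨⟨b.repr x 0 + k * b.repr x 1, b.repr x 1⟩, ?_⟩
    rw [hφ, add_sub_cancel_right]
    simpa [Fin.sum_univ_two] using b.sum_repr x

end NumberField

/-- For each discriminant `d ∈ {-84, -120, -132, -168, -195, -228, -280, -312}`, the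
class group of the imaginary quadratic field of discriminant `d` is isomorphic to
`ℤ/2ℤ × ℤ/2ℤ`. -/
theorem stmt_5 :
    ∀ d ∈ ({-84, -120, -132, -168, -195, -228, -280, -312} : Finset ℤ),
      ∀ (K : Type) [Field K] [NumberField K],
        Module.finrank ℚ K = 2 → NumberField.discr K = d →
          Nonempty (ClassGroup (NumberField.RingOfIntegers K) ≃*
            Multiplicative (ZMod 2 × ZMod 2)) := by
  intro d hd K _ _ hK hdiscr
  suffices ∃ r s : ℤ, d = s * s + 4 * r ∧
      ∀ [IsDedekindDomain (QuadraticAlgebra ℤ r s)],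
        IsKleinFour (ClassGroup (QuadraticAlgebra ℤ r s)) by
    obtain ⟨r, s, rfl, hklein⟩ := this
    obtain ⟨e⟩ := NumberField.nonempty_ringEquiv_quadraticAlgebra hK hdiscr
    have : IsDedekindDomain (QuadraticAlgebra ℤ r s) :=
      { e.toMulEquiv.isDomain with
        toIsNoetherian := isNoetherianRing_of_ringEquiv _ e.symm
        toDimensionLEOne := Ring.DimensionLEOne.of_ringEquiv e
        toIsIntegralClosure := IsIntegrallyClosed.of_equiv e.symm }
    have := hklein
    obtain ⟨f⟩ := IsKleinFour.nonempty_mulEquiv (G₁ := ClassGroup (QuadraticAlgebra ℤ r s))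
      (G₂ := Multiplicative (ZMod 2 × ZMod 2))
    exact ⟨(ClassGroup.mulEquiv e.symm).trans f⟩
  simp only [Finset.mem_insert, Finset.mem_singleton] at hd
  rcases hd with rfl | rfl | rfl | rfl | rfl | rfl | rfl | rfl
  · refine ⟨-21, 0, by decide, fun {_} ↦ ?_⟩
    apply QuadraticAlgebra.isKleinFour_classGroup 2 1 3 0 <;> first | decide | norm_num
  · refine ⟨-30, 0, by decide, fun {_} ↦ ?_⟩
    apply QuadraticAlgebra.isKleinFour_classGroup 2 0 3 0 <;> first | decide | norm_num
  · refine ⟨-33, 0, by decide, fun {_} ↦ ?_⟩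
    apply QuadraticAlgebra.isKleinFour_classGroup 2 1 3 0 <;> first | decide | norm_num
  · refine ⟨-42, 0, by decide, fun {_} ↦ ?_⟩
    apply QuadraticAlgebra.isKleinFour_classGroup 2 0 3 0 <;> first | decide | norm_num
  · refine ⟨-49, 1, by decide, fun {_} ↦ ?_⟩
    apply QuadraticAlgebra.isKleinFour_classGroup 3 1 5 2 <;> first | decide | norm_num
  · refine ⟨-57, 0, by decide, fun {_} ↦ ?_⟩
    apply QuadraticAlgebra.isKleinFour_classGroup 2 1 3 0 <;> first | decide | norm_num
  · refine ⟨-70, 0, by decide, fun {_} ↦ ?_⟩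
    apply QuadraticAlgebra.isKleinFour_classGroup 2 0 5 0 <;> first | decide | norm_num
  · refine ⟨-78, 0, by decide, fun {_} ↦ ?_⟩
    apply QuadraticAlgebra.isKleinFour_classGroup 2 0 3 0 <;> first | decide | norm_num
end
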